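/- arXiv:2303.03134 — 3 statements merged into one kernel-verified Lean document; each statement's English description precedes it below -/
import Mathlib

section
/- Let p ≥ 1, k ≥ 1, and for j = 1, ..., k let n_j ≥ p be integers and B_j be n_j×n_j complex positive definite (self-adjoint) matrices. Let α_1, ..., α_{k+1} be complex numbers with Re(α_j + n_j) > p-1 for j = 1, ..., k and Re(α_{k+1}) > p-1. Then the integral of ∏_{j=1}^k det(X_j* B_j X_j)^{α_j} · det(I - X_1* B_1 X_1 - ... - X_k* B_k X_k)^{α_{k+1} - p} over all tuples (X_1, ..., X_k), where X_j ranges over n_j×p complex matrices, taken over the region where each X_j* B_j X_j is positive definite and I - Σ_{j=1}^k X_j* B_j X_j is positive definite, with respect to Lebesgue measure on each matrix space, equals ( ∏_{j=1}^k det(B_j)^{-p} (π^{n_j p}/Γ̃_p(n_j)) Γ̃_p(α_j + n_j) ) · Γ̃_p(α_{k+1}) / Γ̃_p(α_1 + ... + α_{k+1} + n_1 + ... + n_k). Equivalently, the normalizing constant of the rectangular complex matrix-variate type-1 Dirichlet density is G̃_k = ( ∏_{j=1}^k det(B_j)^{p} (Γ̃_p(n_j)/π^{n_j p}) (1/Γ̃_p(α_j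 + n_j)) ) · Γ̃_p(α_1 + ... + α_{k+1} + n_1 + ... + n_k) / Γ̃_p(α_{k+1}). -/
open MeasureTheory Matrix
open scoped ComplexOrder

noncomputable section

/-- Parameter space `ℝ^p × ℂ^{p(p-1)/2}` for `p × p` Hermitian matrices:
the real diagonal entries together with the strictly upper-triangular complex entries. -/
abbrev HermParam (p : ℕ) : Type :=
  (Fin p → ℝ) × ({ q : Fin p × Fin p // q.1 < q.2 } → ℂ)

/-- The linear isomorphism sending the parameters to the corresponding self-adjoint matrix. -/
def toHermMatrix (p : ℕ) (T : HermParam p) : Matrix (Fin p) (Fin p) ℂ :=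
  Matrix.of fun i j =>
    if h : i < j then T.2 ⟨(i, j), h⟩
    else if h' : j < i then (starRingEnd ℂ) (T.2 ⟨(j, i), h'⟩)
    else (T.1 i : ℂ)

noncomputable instance matrixComplexMeasureSpace (m n : ℕ) :
    MeasureSpace (Matrix (Fin m) (Fin n) ℂ) :=
  inferInstanceAs (MeasureSpace (Fin m → Fin n → ℂ))

/-- The Lebesgue measure `μ_p` on Herm(p), realized as a measure on the space of
`p × p` complex matrices: the pushforward of Lebesgue measure on the parameter space
under the linear isomorphism `toHermMatrix p`. -/
def hermLebesgue (p : ℕ) : Measure (Matrix (Fin p) (Fin p) ℂ) :=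
  Measure.map (toHermMatrix p) volume

/-- The complex matrix-variate gamma function
`Γ̃_p(α) = π^{p(p-1)/2} ∏_{j=1}^p Γ(α - j + 1) = π^{p(p-1)/2} ∏_{j=0}^{p-1} Γ(α - j)`. -/
def cGammaP (p : ℕ) (α : ℂ) : ℂ :=
  (Real.pi : ℂ) ^ (p * (p - 1) / 2) * ∏ j : Fin p, Complex.Gamma (α - j)

end

open scoped ENNReal

section LinearAlgebra

variable {m q : Type*} [Fintype m] [Fintype q] [DecidableEq m] [DecidableEq q]

open scoped MatrixOrder Matrix.Norms.L2Operator in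
theorem Matrix.PosDef.exists_eq_conjTranspose_mul_self {C : Matrix q q ℂ} (hC : C.PosDef) :
    ∃ D : Matrix q q ℂ, D.det ≠ 0 ∧ C = Dᴴ * D := by
  obtain ⟨D, hD⟩ := CStarAlgebra.nonneg_iff_eq_star_mul_self.mp hC.posSemidef.nonneg
  refine ⟨D, fun h => ?_, hD⟩
  have := hC.det_pos.ne'
  rw [hD, det_mul, h, mul_zero] at this
  exact this rfl

theorem Matrix.posDef_conjTranspose_mul_mul_iff {D M : Matrix q q ℂ} (hD : D.det ≠ 0) :
    (Dᴴ * M * D).PosDef ↔ M.PosDef :=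
  Matrix.IsUnit.posDef_star_left_conjugate_iff ((isUnit_iff_isUnit_det D).2 hD.isUnit)

theorem Matrix.det_conjTranspose_mul_mul_re (D M : Matrix q q ℂ) :
    (Dᴴ * M * D).det.re = ‖D.det‖ ^ 2 * M.det.re := by
  rw [det_mul, det_mul, det_conjTranspose, mul_right_comm, Complex.star_def, ← Complex.normSq_eq_conj_mul_self,
    Complex.re_ofReal_mul, Complex.normSq_eq_norm_sq]

theorem Matrix.det_conjTranspose_mul_self_re (D : Matrix q q ℂ) :
    (Dᴴ * D).det.re = ‖D.det‖ ^ 2 := by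
  simpa using det_conjTranspose_mul_mul_re D 1

theorem Matrix.exists_unitary_mulVec_single (x : q → ℂ) (i : q) :
    ∃ U : Matrix q q ℂ, Uᴴ * U = 1 ∧ ‖U.det‖ = 1 ∧
      x = U *ᵥ Pi.single i ((Real.sqrt (∑ j, ‖x j‖ ^ 2) : ℝ) : ℂ) := by
  set r := Real.sqrt (∑ j, ‖x j‖ ^ 2) with hr
  by_cases h0 : r = 0
  · refine ⟨1, by simp, by simp, ?_⟩
    have : ∑ j, ‖x j‖ ^ 2 = 0 := by
      rw [hr, Real.sqrt_eq_zero (by positivity)] at h0; exact h0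
    rw [Finset.sum_eq_zero_iff_of_nonneg (by intros; positivity)] at this
    ext j
    have := this j (Finset.mem_univ _)
    simp [h0] at this ⊢
    exact this
  · have hn : ‖WithLp.toLp 2 x‖ = r := by rw [EuclideanSpace.norm_eq]
    obtain ⟨b, hb⟩ := Orthonormal.exists_orthonormalBasis_extension_of_card_eq
      (𝕜 := ℂ) (E := EuclideanSpace ℂ q) (ι := q) (by simp)
      (v := fun _ => ((r : ℂ)⁻¹) • WithLp.toLp 2 x) (s := {i}) (by
        refine ⟨?_, ?_⟩
        · rintro ⟨j, hj⟩
          simp only [Set.domRestrict_apply, norm_smul, norm_inv, hn, Complex.norm_real, Real.norm_eq_abs]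
          rw [abs_of_nonneg (by positivity)]
          field_simp
        · intro a b hab
          exact absurd (Subsingleton.elim a b) hab)
    have hb := hb i rfl
    let e := EuclideanSpace.basisFun q ℂ
    refine ⟨e.toBasis.toMatrix b, ?_, ?_, ?_⟩
    · exact e.toMatrix_orthonormalBasis_conjTranspose_mul_self b
    · exact e.det_to_matrix_orthonormalBasis b
    · ext j
      have hr' : (r : ℂ) ≠ 0 := by exact_mod_cast h0
      simp only [mulVec_single, e]
      simp [Module.Basis.toMatrix_apply, hb]
      field_simp
end LinearAlgebra

section Jacobian

variable {m q : Type*} [Fintype m] [Fintype q] [DecidableEq m] [DecidableEq q]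

/-- The linear map `X ↦ E * X * D` on rectangular matrices, seen as functions. -/
def mulMulLin (E : Matrix m m ℂ) (D : Matrix q q ℂ) : (m → q → ℂ) →ₗ[ℂ] (m → q → ℂ) :=
  (mulLeftLinearMap q ℂ E : Matrix m q ℂ →ₗ[ℂ] Matrix m q ℂ) ∘ₗ
    (mulRightLinearMap m ℂ D : Matrix m q ℂ →ₗ[ℂ] Matrix m q ℂ)

omit [DecidableEq m] in
theorem det_mulRightLinearMap (D : Matrix q q ℂ) :
    LinearMap.det (mulRightLinearMap m ℂ D : Matrix m q ℂ →ₗ[ℂ] Matrix m q ℂ) =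
      D.det ^ Fintype.card m := by
  have h : (mulRightLinearMap m ℂ D : Matrix m q ℂ →ₗ[ℂ] Matrix m q ℂ) =
      (LinearMap.pi fun i : m => (toLin' Dᵀ).comp (LinearMap.proj i) :
        (m → q → ℂ) →ₗ[ℂ] (m → q → ℂ)) := by
    refine LinearMap.ext fun X => ?_
    funext i j
    show ∑ k, X i k * D k j = ∑ k, D k j * X i k
    simp only [mul_comm]
  rw [h]
  refine (LinearMap.det_pi _).trans ?_
  simp

omit [DecidableEq q] in
theorem det_mulLeftLinearMap (E : Matrix m m ℂ) :
    LinearMap.det (mulLeftLinearMap q ℂ E : Matrix m q ℂ →ₗ[ℂ] Matrix m q ℂ) =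
      E.det ^ Fintype.card q := by
  rw [← det_transpose E, ← det_mulRightLinearMap (m := q), ← LinearMap.det_conj _ (transposeLinearEquiv q m ℂ ℂ)]
  congr 1
  ext X i j
  simp [transposeLinearEquiv, ← transpose_mul]

theorem det_mulMulLin (E : Matrix m m ℂ) (D : Matrix q q ℂ) :
    LinearMap.det (mulMulLin E D) = E.det ^ Fintype.card q * D.det ^ Fintype.card m := by
  rw [← det_mulLeftLinearMap (q := q), ← det_mulRightLinearMap (m := m)]
  exact LinearMap.det_comp _ _

/-- Change of variables `X = E * Y * D` in an integral over rectangular complex matrices. -/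
theorem lintegral_mul_mul (E : Matrix m m ℂ) (D : Matrix q q ℂ) (hE : E.det ≠ 0) (hD : D.det ≠ 0)
    {G : (m → q → ℂ) → ℝ≥0∞} (hG : Measurable G) :
    ∫⁻ X, G X = ENNReal.ofReal ((‖E.det‖ ^ 2) ^ Fintype.card q * (‖D.det‖ ^ 2) ^ Fintype.card m) *
      ∫⁻ Y : m → q → ℂ, G (of.symm (E * of Y * D)) := by
  set f := (mulMulLin E D).restrictScalars ℝ with hf
  have hdet : LinearMap.det f = (‖E.det‖ ^ 2) ^ Fintype.card q * (‖D.det‖ ^ 2) ^ Fintype.card m := by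
    rw [hf, LinearMap.det_restrictScalars, det_mulMulLin, Algebra.norm_complex_apply,
      Complex.normSq_eq_norm_sq]
    simp
    ring
  have hpos : 0 < LinearMap.det f := by
    have := norm_pos_iff.2 hE
    have := norm_pos_iff.2 hD
    rw [hdet]; positivity
  have hm : Measurable f := (LinearMap.continuous_of_finiteDimensional f).measurable
  have : Measure.IsAddHaarMeasure (volume : Measure (m → q → ℂ)) := by
    have : Measure.IsAddHaarMeasure (volume : Measure (q → ℂ)) := inferInstance
    exact Measure.pi.isAddHaarMeasure _
  have h1 := Measure.map_linearMap_addHaar_eq_smul_addHaar (volume : Measure (m → q → ℂ)) hpos.ne'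
  have h2 : ∫⁻ Y : m → q → ℂ, G (of.symm (E * of Y * D)) = ENNReal.ofReal (LinearMap.det f)⁻¹ * ∫⁻ X, G X := by
    have : ∀ Y : m → q → ℂ, of.symm (E * of Y * D) = f Y := fun Y => by
      simp [hf, mulMulLin, Matrix.mul_assoc]
      rfl
    simp_rw [this]
    rw [← lintegral_map hG hm, h1, lintegral_smul_measure, abs_of_pos (inv_pos.2 hpos)]
    rfl
  rw [h2, ← hdet, ← mul_assoc, ← ENNReal.ofReal_mul hpos.le, mul_inv_cancel₀ hpos.ne']
  simp

end Jacobian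

section GramLaw

variable {m q : Type*} [Fintype m] [Fintype q] [DecidableEq m] [DecidableEq q]

omit [DecidableEq q] in
theorem Matrix.isClosed_setOf_posSemidef : IsClosed {M : Matrix q q ℂ | M.PosSemidef} := by
  simp only [posSemidef_iff_dotProduct_mulVec, Set.ofPred_and, Set.ofPred_forall]
  refine IsClosed.inter ?_ (isClosed_iInter fun x => ?_)
  · exact isClosed_eq (by fun_prop) continuous_id
  · exact isClosed_le continuous_const (by fun_prop)

theorem Matrix.measurableSet_setOf_posDef {Y : Type*} [TopologicalSpace Y] [MeasurableSpace Y]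
    [OpensMeasurableSpace Y] {M : Y → Matrix q q ℂ} (hM : Continuous M) :
    MeasurableSet {y | (M y).PosDef} := by
  have : {y | (M y).PosDef} = M ⁻¹' {M | M.PosSemidef} ∩ {y | (M y).det ≠ 0} := by
    ext y
    exact ⟨fun h => ⟨h.posSemidef, h.posSemidef.posDef_iff_det_ne_zero.1 h⟩,
      fun h => (PosSemidef.posDef_iff_det_ne_zero h.1).2 h.2⟩
  rw [this]
  refine (isClosed_setOf_posSemidef.preimage hM).measurableSet.inter ?_
  exact (isOpen_ne_fun (by fun_prop) continuous_const).measurableSet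

/-- The pair of determinants attached to the Gram matrix `Xᴴ * X`. -/
noncomputable def gramDets (X : m → q → ℂ) : ℝ × ℝ :=
  (((of X)ᴴ * of X).det.re, (1 - (of X)ᴴ * of X).det.re)

/-- The ball `{X | 0 < 1 - Xᴴ * X}` of rectangular complex matrices. -/
def matrixBall (m q : Type*) [Fintype m] [Fintype q] [DecidableEq q] : Set (m → q → ℂ) :=
  {X | (1 - (of X)ᴴ * of X).PosDef}

/-- The image of Lebesgue measure on the matrix ball under the
pair of determinants `(det (Xᴴ * X), det (1 - Xᴴ * X))`. -/
noncomputable def gramLaw (m q : Type*) [Fintype m] [Fintype q] [DecidableEq q] :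
    Measure (ℝ × ℝ) :=
  (volume.restrict (matrixBall m q)).map gramDets

omit [Fintype q] [Fintype m] [DecidableEq m] [DecidableEq q] in
theorem continuous_matrix_of : Continuous (fun X : m → q → ℂ => of X) := continuous_id

omit [DecidableEq m] in
theorem measurable_gramDets : Measurable (gramDets : (m → q → ℂ) → ℝ × ℝ) := by
  have := continuous_matrix_of (m := m) (q := q)
  unfold gramDets
  exact Continuous.measurable (by fun_prop)

omit [DecidableEq m] in
theorem measurableSet_matrixBall :
    MeasurableSet (matrixBall m q) := by
  have := continuous_matrix_of (m := m) (q := q)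
  exact measurableSet_setOf_posDef (by fun_prop)

instance : SFinite (gramLaw m q) := by unfold gramLaw; infer_instance

omit [DecidableEq m] in
theorem lintegral_gramLaw {F : ℝ × ℝ → ℝ≥0∞} (hF : Measurable F) :
    ∫⁻ z, F z ∂gramLaw m q =
      ∫⁻ X in matrixBall m q, F (gramDets X) := by
  rw [gramLaw, lintegral_map hF measurable_gramDets]

/-- Rescaling of the matrix ball: the ellipsoid `{X | 0 < C - Xᴴ * B * X}` reduces to the
unit ball. -/
theorem lintegral_ellipsoid {C : Matrix q q ℂ} {B : Matrix m m ℂ} (hC : C.PosDef) (hB : B.PosDef)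
    {F : ℝ × ℝ → ℝ≥0∞} (hF : Measurable F) :
    ∫⁻ X in {X : m → q → ℂ | (C - (of X)ᴴ * B * of X).PosDef},
      F (((of X)ᴴ * B * of X).det.re, (C - (of X)ᴴ * B * of X).det.re) =
    ENNReal.ofReal ((B.det.re ^ Fintype.card q)⁻¹ * C.det.re ^ Fintype.card m) *
      ∫⁻ z, F (C.det.re * z.1, C.det.re * z.2) ∂gramLaw m q := by
  obtain ⟨D, hD, rfl⟩ := hC.exists_eq_conjTranspose_mul_self
  obtain ⟨E, hE, rfl⟩ := hB.exists_eq_conjTranspose_mul_self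
  have hof := continuous_matrix_of (m := m) (q := q)
  have hS : MeasurableSet {X : m → q → ℂ | (Dᴴ * D - (of X)ᴴ * (Eᴴ * E) * of X).PosDef} :=
    measurableSet_setOf_posDef (by fun_prop)
  have hG : Measurable fun X : m → q → ℂ => F (((of X)ᴴ * (Eᴴ * E) * of X).det.re,
      (Dᴴ * D - (of X)ᴴ * (Eᴴ * E) * of X).det.re) :=
    hF.comp (Continuous.measurable (by fun_prop))
  have hE' : E⁻¹.det ≠ 0 := by
    rw [det_nonsing_inv, Ring.inverse_eq_inv']
    exact inv_ne_zero hE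
  have hF' : Measurable fun z : ℝ × ℝ => F ((Dᴴ * D).det.re * z.1, (Dᴴ * D).det.re * z.2) :=
    hF.comp (by fun_prop)
  rw [← lintegral_indicator hS, lintegral_mul_mul E⁻¹ D hE' hD (hG.indicator hS),
    lintegral_gramLaw hF', ← lintegral_indicator measurableSet_matrixBall]
  have hgram : ∀ Y : m → q → ℂ, (of (of.symm (E⁻¹ * of Y * D)))ᴴ * (Eᴴ * E) *
      of (of.symm (E⁻¹ * of Y * D)) = Dᴴ * ((of Y)ᴴ * of Y) * D := by
    intro Y
    have hE1 : E * E⁻¹ = 1 := mul_nonsing_inv _ hE.isUnit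
    have hE2 : (E⁻¹)ᴴ * Eᴴ = 1 := by rw [← conjTranspose_mul, hE1, conjTranspose_one]
    calc (E⁻¹ * of Y * D)ᴴ * (Eᴴ * E) * (E⁻¹ * of Y * D)
        = Dᴴ * ((of Y)ᴴ * (((E⁻¹)ᴴ * Eᴴ) * (E * E⁻¹)) * of Y) * D := by
          simp only [conjTranspose_mul, Matrix.mul_assoc]
      _ = _ := by rw [hE1, hE2]; simp
  have hsub : ∀ Y : m → q → ℂ, Dᴴ * D - Dᴴ * ((of Y)ᴴ * of Y) * D =
      Dᴴ * (1 - (of Y)ᴴ * of Y) * D := fun Y => by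
    rw [Matrix.mul_sub, Matrix.sub_mul, Matrix.mul_one]
  congr 2
  · rw [det_conjTranspose_mul_self_re, det_conjTranspose_mul_self_re, det_nonsing_inv,
      Ring.inverse_eq_inv', norm_inv, inv_pow, inv_pow]
  · funext Y
    by_cases hY : (1 - (of Y)ᴴ * of Y).PosDef
    · rw [Set.indicator_of_mem, Set.indicator_of_mem (show Y ∈ matrixBall m q from hY)]
      · rw [hgram, hsub, det_conjTranspose_mul_mul_re, det_conjTranspose_mul_mul_re,
          det_conjTranspose_mul_self_re]
        rfl
      · rw [Set.mem_ofPred_eq, hgram, hsub]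
        exact (posDef_conjTranspose_mul_mul_iff hD).2 hY
    · rw [Set.indicator_of_notMem, Set.indicator_of_notMem (show Y ∉ matrixBall m q from hY)]
      rw [Set.mem_ofPred_eq, hgram, hsub]
      exact fun h => hY ((posDef_conjTranspose_mul_mul_iff hD).1 h)

end GramLaw

section Blocks

variable {m q a : Type*} [Fintype m] [Fintype q] [Fintype a]
  [DecidableEq m] [DecidableEq q] [DecidableEq a]

theorem Matrix.posDef_one_sub_conjTranspose_mul_self_comm (s : Matrix a q ℂ) :
    (1 - sᴴ * s).PosDef ↔ (1 - s * sᴴ).PosDef := by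
  let _ : Invertible (1 : Matrix a a ℂ) := invertibleOne
  have h1 := PosDef.fromBlocks₁₁ (A := (1 : Matrix a a ℂ)) s (1 : Matrix q q ℂ) PosDef.one
  let _ : Invertible (1 : Matrix q q ℂ) := invertibleOne
  have h2 := PosDef.fromBlocks₂₂ (1 : Matrix a a ℂ) s (D := (1 : Matrix q q ℂ)) PosDef.one
  simp only [inv_one, Matrix.mul_one] at h1 h2
  have h : (1 - sᴴ * s).PosSemidef ↔ (1 - s * sᴴ).PosSemidef := h1.symm.trans h2
  have hdet := det_one_sub_mul_comm sᴴ s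
  constructor <;> intro hp
  · exact (PosSemidef.posDef_iff_det_ne_zero (h.1 hp.posSemidef)).2 (hdet ▸ hp.det_pos.ne')
  · exact (PosSemidef.posDef_iff_det_ne_zero (h.2 hp.posSemidef)).2 (hdet ▸ hp.det_pos.ne')

theorem Matrix.posDef_fromBlocks_one_zero (M : Matrix q q ℂ) :
    (fromBlocks (1 : Matrix a a ℂ) 0 0 M).PosDef ↔ M.PosDef := by
  let _ : Invertible (1 : Matrix a a ℂ) := invertibleOne
  have h1 := PosDef.fromBlocks₁₁ (A := (1 : Matrix a a ℂ)) 0 M PosDef.one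
  simp only [inv_one, Matrix.mul_zero, conjTranspose_zero, sub_zero] at h1
  have hdet : (fromBlocks (1 : Matrix a a ℂ) 0 0 M).det = M.det := by simp
  constructor <;> intro hp
  · exact (PosSemidef.posDef_iff_det_ne_zero (h1.1 hp.posSemidef)).2 (hdet ▸ hp.det_pos.ne')
  · exact (PosSemidef.posDef_iff_det_ne_zero (h1.2 hp.posSemidef)).2 (hdet ▸ hp.det_pos.ne')

/-- The squared Hermitian norm of a complex vector. -/
noncomputable def sqNorm (x : m → ℂ) : ℝ := ∑ i, ‖x i‖ ^ 2

omit [DecidableEq m] in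
theorem sqNorm_nonneg (x : m → ℂ) : 0 ≤ sqNorm x := Finset.sum_nonneg fun _ _ => sq_nonneg _

omit [DecidableEq m] in
theorem measurable_sqNorm : Measurable (sqNorm : (m → ℂ) → ℝ) := by
  unfold sqNorm; fun_prop

omit [DecidableEq q] in
theorem replicateRow_mul_conjTranspose (s : q → ℂ) :
    replicateRow Unit s * (replicateRow Unit s)ᴴ = diagonal fun _ => (sqNorm s : ℂ) := by
  ext i j
  simp [Matrix.mul_apply, sqNorm, Complex.mul_conj, Complex.normSq_eq_norm_sq]

omit [DecidableEq q] in
theorem one_sub_replicateRow_mul (s : q → ℂ) :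
    1 - replicateRow Unit s * (replicateRow Unit s)ᴴ =
      diagonal fun _ => ((1 - sqNorm s : ℝ) : ℂ) := by
  rw [replicateRow_mul_conjTranspose]
  ext i j
  simp

theorem posDef_one_sub_replicateRow_iff (s : q → ℂ) :
    (1 - (replicateRow Unit s)ᴴ * replicateRow Unit s).PosDef ↔ sqNorm s < 1 := by
  rw [posDef_one_sub_conjTranspose_mul_self_comm, one_sub_replicateRow_mul, posDef_diagonal_iff]
  simp only [forall_const, Complex.zero_lt_real, sub_pos]

theorem det_one_sub_replicateRow_re (s : q → ℂ) :
    (1 - (replicateRow Unit s)ᴴ * replicateRow Unit s).det.re = 1 - sqNorm s := by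
  rw [det_one_sub_mul_comm, one_sub_replicateRow_mul, det_diagonal]
  simp only [Finset.univ_unique, Finset.prod_singleton, Complex.ofReal_re]

variable (ρ σ : ℝ) (s : Matrix Unit q ℂ) (Y : Matrix m q ℂ)

omit [DecidableEq m] in
theorem det_gram_fromBlocks_re :
    ((fromBlocks (diagonal fun _ => (ρ : ℂ)) ((σ : ℂ) • s) 0 Y)ᴴ *
      fromBlocks (diagonal fun _ => (ρ : ℂ)) ((σ : ℂ) • s) 0 Y).det.re =
      ρ ^ 2 * (Yᴴ * Y).det.re := by
  set T : Matrix (Unit ⊕ q) (Unit ⊕ q) ℂ := fromBlocks (diagonal fun _ => (ρ : ℂ)) ((σ : ℂ) • s) 0 1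
  have h : fromBlocks (diagonal fun _ => (ρ : ℂ)) ((σ : ℂ) • s) 0 Y =
      fromBlocks (1 : Matrix Unit Unit ℂ) 0 0 Y * T := by
    simp [T, fromBlocks_multiply]
  have h2 : (fromBlocks (1 : Matrix Unit Unit ℂ) 0 0 Y)ᴴ * fromBlocks (1 : Matrix Unit Unit ℂ) 0 0 Y =
      (fromBlocks 1 0 0 (Yᴴ * Y) : Matrix (Unit ⊕ q) (Unit ⊕ q) ℂ) := by
    simp [fromBlocks_conjTranspose, fromBlocks_multiply]
  rw [h, conjTranspose_mul, Matrix.mul_assoc, ← Matrix.mul_assoc _ _ T, h2, ← Matrix.mul_assoc,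
    det_conjTranspose_mul_mul_re]
  simp [T]

variable {ρ σ}

omit [DecidableEq m] in
theorem one_sub_gram_fromBlocks (h : ρ ^ 2 + σ ^ 2 = 1) :
    1 - (fromBlocks (diagonal fun _ => (ρ : ℂ)) ((σ : ℂ) • s) 0 Y)ᴴ *
      fromBlocks (diagonal fun _ => (ρ : ℂ)) ((σ : ℂ) • s) 0 Y =
    (fromBlocks (diagonal fun _ => (σ : ℂ)) (-(ρ : ℂ) • s) 0 1)ᴴ *
      fromBlocks (1 : Matrix Unit Unit ℂ) 0 0 (1 - sᴴ * s - Yᴴ * Y) *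
      fromBlocks (diagonal fun _ => (σ : ℂ)) (-(ρ : ℂ) • s) 0 1 := by
  have hc : σ * σ = 1 - ρ * ρ := by rw [← h]; ring
  have e : ∀ c : ℂ, (diagonal fun _ : Unit => c) = c • (1 : Matrix Unit Unit ℂ) := fun c =>
    (smul_one_eq_diagonal c).symm
  rw [sub_eq_iff_eq_add, ← fromBlocks_one]
  simp only [e, fromBlocks_conjTranspose, fromBlocks_multiply, fromBlocks_add,
    conjTranspose_smul, conjTranspose_one, conjTranspose_zero]
  simp only [fromBlocks_inj]
  simp [smul_smul, hc, sub_smul, mul_comm σ ρ]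
  abel

omit [DecidableEq m] in
theorem posDef_one_sub_gram_fromBlocks (h : ρ ^ 2 + σ ^ 2 = 1) (hσ : σ ≠ 0) :
    (1 - (fromBlocks (diagonal fun _ => (ρ : ℂ)) ((σ : ℂ) • s) 0 Y)ᴴ *
      fromBlocks (diagonal fun _ => (ρ : ℂ)) ((σ : ℂ) • s) 0 Y).PosDef ↔
    (1 - sᴴ * s - Yᴴ * Y).PosDef := by
  rw [one_sub_gram_fromBlocks s Y h, posDef_conjTranspose_mul_mul_iff, posDef_fromBlocks_one_zero]
  simpa using hσ

omit [DecidableEq m] in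
theorem det_one_sub_gram_fromBlocks_re (h : ρ ^ 2 + σ ^ 2 = 1) :
    (1 - (fromBlocks (diagonal fun _ => (ρ : ℂ)) ((σ : ℂ) • s) 0 Y)ᴴ *
      fromBlocks (diagonal fun _ => (ρ : ℂ)) ((σ : ℂ) • s) 0 Y).det.re =
    σ ^ 2 * (1 - sᴴ * s - Yᴴ * Y).det.re := by
  rw [one_sub_gram_fromBlocks s Y h, det_conjTranspose_mul_mul_re]
  simp

end Blocks

section Splitting

variable {m q a β : Type*} [Fintype m] [Fintype q] [Fintype a]

theorem measurePreserving_sum_elim_unit [MeasureSpace β] [SigmaFinite (volume : Measure β)] :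
    MeasurePreserving (fun z : β × (m → β) => (Sum.elim (fun _ => z.1) z.2 : Unit ⊕ m → β))
      (volume.prod volume) volume := by
  have h1 : MeasurePreserving (fun z : β × (m → β) => ((fun _ : Unit => z.1), z.2))
      (volume.prod volume) (volume.prod volume) :=
    (volume_preserving_funUnique Unit β).symm.prod (MeasurePreserving.id _)
  exact (volume_measurePreserving_sumPiEquivProdPi_symm (fun _ : Unit ⊕ m => β)).comp h1

theorem lintegral_sum_elim_unit [MeasureSpace β] [SigmaFinite (volume : Measure β)]
    {G : (Unit ⊕ m → β) → ℝ≥0∞} (hG : Measurable G) :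
    ∫⁻ X, G X = ∫⁻ r : β, ∫⁻ Y : m → β, G (Sum.elim (fun _ => r) Y) := by
  have h := measurePreserving_sum_elim_unit (m := m) (β := β)
  rw [← h.lintegral_comp hG, lintegral_prod]
  exact (hG.comp h.measurable).aemeasurable

theorem measurePreserving_pi_sum_elim_unit [MeasureSpace β] [SigmaFinite (volume : Measure β)] :
    MeasurePreserving (fun z : (a → β) × (a → q → β) =>
      (fun i => Sum.elim (fun _ => z.1 i) (z.2 i) : a → Unit ⊕ q → β))
      (volume.prod volume) volume := by
  have h1 : MeasurePreserving (fun z : a → β × (q → β) =>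
      (fun i => Sum.elim (fun _ => (z i).1) (z i).2 : a → Unit ⊕ q → β)) volume volume :=
    volume_preserving_pi (f := fun (_ : a) (z : β × (q → β)) =>
      (Sum.elim (fun _ => z.1) z.2 : Unit ⊕ q → β)) fun _ => measurePreserving_sum_elim_unit
  exact h1.comp (volume_measurePreserving_arrowProdEquivProdArrow β (q → β) a).symm

theorem lintegral_pi_sum_elim_unit [MeasureSpace β] [SigmaFinite (volume : Measure β)]
    {G : (a → Unit ⊕ q → β) → ℝ≥0∞} (hG : Measurable G) :
    ∫⁻ X, G X = ∫⁻ x : a → β, ∫⁻ X' : a → q → β, G (fun i => Sum.elim (fun _ => x i) (X' i)) := by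
  have h := measurePreserving_pi_sum_elim_unit (a := a) (q := q) (β := β)
  rw [← h.lintegral_comp hG, lintegral_prod]
  exact (hG.comp h.measurable).aemeasurable

end Splitting

section Recursion

variable {m q : Type*} [Fintype m] [Fintype q] [DecidableEq m] [DecidableEq q]

/-- Prepend the column `x` to the array `X`. -/
def prependCol {a q : Type*} (x : a → ℂ) (X : a → q → ℂ) : a → Unit ⊕ q → ℂ :=
  fun i => Sum.elim (fun _ => x i) (X i)

/-- Prepend the row `s` to the array `Y`. -/
def prependRow {m q : Type*} (s : q → ℂ) (Y : m → q → ℂ) : Unit ⊕ m → q → ℂ :=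
  Sum.elim (fun _ => s) Y

omit [Fintype q] [DecidableEq q] in
theorem of_prependCol_mulVec_mul (U : Matrix (Unit ⊕ m) (Unit ⊕ m) ℂ) (ρ σ : ℂ) (s : q → ℂ)
    (Y : m → q → ℂ) :
    prependCol (U *ᵥ Pi.single (Sum.inl ()) ρ)
      (of.symm (U * (fromBlocks (diagonal fun _ : Unit => σ) 0 0 1 : Matrix (Unit ⊕ m) (Unit ⊕ m) ℂ) * of (prependRow s Y))) =
    of.symm (U * fromBlocks (diagonal fun _ => ρ) (σ • replicateRow Unit s) 0 (of Y)) := by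
  have h : (fromBlocks (diagonal fun _ : Unit => σ) 0 0 1 : Matrix (Unit ⊕ m) (Unit ⊕ m) ℂ) * of (prependRow s Y) =
      of (prependRow (σ • s) Y) := by
    ext (i | i) j
    · simp [Matrix.mul_apply, prependRow]
    · simp [Matrix.mul_apply, prependRow, Matrix.one_apply]
  rw [Matrix.mul_assoc, h]
  ext i (j | j)
  · simp [Matrix.mul_apply, prependCol, mulVec, dotProduct]
  · simp [Matrix.mul_apply, prependCol, prependRow]

omit [DecidableEq m] in
theorem sqNorm_lt_one_of_mem_matrixBall (x : m → ℂ) (X : m → q → ℂ)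
    (h : prependCol x X ∈ matrixBall m (Unit ⊕ q)) :
    sqNorm x < 1 := by
  have h1 := PosDef.diag_pos (show Matrix.PosDef _ from h) (i := Sum.inl ())
  have h2 : ((1 : Matrix (Unit ⊕ q) (Unit ⊕ q) ℂ) -
      (of (prependCol x X))ᴴ *
      of (prependCol x X)) (Sum.inl ()) (Sum.inl ()) =
      ((1 - sqNorm x : ℝ) : ℂ) := by
    simp [Matrix.mul_apply, sqNorm, prependCol, Complex.conj_mul']
  rw [h2, Complex.zero_lt_real] at h1
  linarith

omit [DecidableEq m] in
theorem sqNorm_lt_one_of_posDef (s : q → ℂ) (Y : Matrix m q ℂ)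
    (h : (1 - (replicateRow Unit s)ᴴ * replicateRow Unit s - Yᴴ * Y).PosDef) : sqNorm s < 1 := by
  rw [← posDef_one_sub_replicateRow_iff]
  simpa using h.add_posSemidef (posSemidef_conjTranspose_mul_self Y)

theorem lintegral_slice {F : ℝ × ℝ → ℝ≥0∞} (hF : Measurable F) (x : Unit ⊕ m → ℂ)
    (hx : sqNorm x < 1) :
    ∫⁻ X : Unit ⊕ m → q → ℂ, (matrixBall (Unit ⊕ m) (Unit ⊕ q)).indicator
        (fun X => F (gramDets X)) (prependCol x X) =
      ENNReal.ofReal ((1 - sqNorm x) ^ Fintype.card q) *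
        ∫⁻ s : q → ℂ in {s | sqNorm s < 1}, ENNReal.ofReal ((1 - sqNorm s) ^ Fintype.card m) *
          ∫⁻ z, F (sqNorm x * ((1 - sqNorm s) * z.1), (1 - sqNorm x) * ((1 - sqNorm s) * z.2))
            ∂gramLaw m q := by
  obtain ⟨U, hU, hUdet, hxU⟩ := exists_unitary_mulVec_single x (Sum.inl ())
  set ρ := √(sqNorm x) with hρ
  change x = U *ᵥ Pi.single (Sum.inl ()) (ρ : ℂ) at hxU
  set σ := √(1 - sqNorm x) with hσ
  have hρ2 : ρ ^ 2 = sqNorm x := Real.sq_sqrt (sqNorm_nonneg x)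
  have hσ2 : σ ^ 2 = 1 - sqNorm x := Real.sq_sqrt (by linarith)
  have hσ0 : σ ≠ 0 := (Real.sqrt_pos.2 (by linarith)).ne'
  have hsum : ρ ^ 2 + σ ^ 2 = 1 := by rw [hρ2, hσ2]; ring
  set E : Matrix (Unit ⊕ m) (Unit ⊕ m) ℂ := U * fromBlocks (diagonal fun _ => (σ : ℂ)) 0 0 1
  have hEdet : ‖E.det‖ ^ 2 = 1 - sqNorm x := by
    simp [E, hUdet, hσ2]
  have hE0 : E.det ≠ 0 := by
    intro h
    rw [h] at hEdet
    simp at hEdet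
    linarith
  have hcons : Measurable fun X : Unit ⊕ m → q → ℂ =>
      prependCol x X := by
    refine measurable_pi_lambda _ fun i => measurable_pi_lambda _ fun j => ?_
    rcases j with j | j
    · exact measurable_const
    · exact (measurable_pi_apply j).comp (measurable_pi_apply i)
  have hball : MeasurableSet (matrixBall (Unit ⊕ m) (Unit ⊕ q)) := measurableSet_matrixBall
  have hmeas : Measurable fun X : Unit ⊕ m → q → ℂ =>
      (matrixBall (Unit ⊕ m) (Unit ⊕ q)).indicator
        (fun X => F (gramDets X)) (prependCol x X) :=
    ((hF.comp measurable_gramDets).indicator hball).comp hcons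
  rw [lintegral_mul_mul E 1 hE0 (by simp) hmeas, hEdet, det_one, norm_one, one_pow, one_pow, mul_one]
  congr 1
  have hlin : Measurable fun Y : Unit ⊕ m → q → ℂ =>
      of.symm (E * of Y * (1 : Matrix q q ℂ)) := by
    have := continuous_matrix_of (m := Unit ⊕ m) (q := q)
    have h2 : Continuous fun Y : Unit ⊕ m → q → ℂ => E * of Y * (1 : Matrix q q ℂ) := by fun_prop
    exact Continuous.measurable (f := fun Y : Unit ⊕ m → q → ℂ =>
      of.symm (E * of Y * (1 : Matrix q q ℂ))) h2
  have hmeas' := hmeas.comp hlin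
  simp only [Function.comp_def] at hmeas'
  refine (lintegral_sum_elim_unit hmeas').trans ?_
  rw [
    ← lintegral_indicator (measurableSet_lt measurable_sqNorm measurable_const)]
  refine lintegral_congr fun s => ?_
  set S := replicateRow Unit s
  have hgram : ∀ Y : m → q → ℂ, prependCol x (of.symm (E * of (prependRow s Y) * (1 : Matrix q q ℂ))) =
      of.symm (U * fromBlocks (diagonal fun _ => (ρ : ℂ)) ((σ : ℂ) • S) 0 (of Y)) := by
    intro Y
    have := of_prependCol_mulVec_mul U ρ σ s Y
    rw [← hxU] at this
    rw [Matrix.mul_one]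
    exact this
  have hUW : ∀ W : Matrix (Unit ⊕ m) (Unit ⊕ q) ℂ,
      (of (of.symm (U * W)))ᴴ * of (of.symm (U * W)) = Wᴴ * W := by
    intro W
    rw [Equiv.apply_symm_apply, conjTranspose_mul, Matrix.mul_assoc, ← Matrix.mul_assoc Uᴴ, hU,
      Matrix.one_mul]
  have hind : ∀ Y : m → q → ℂ, (matrixBall (Unit ⊕ m) (Unit ⊕ q)).indicator
      (fun X => F (gramDets X)) (prependCol x
        (of.symm (E * of (prependRow s Y) * (1 : Matrix q q ℂ)))) =
      {Y : m → q → ℂ | (1 - Sᴴ * S - (of Y)ᴴ * (1 : Matrix m m ℂ) * of Y).PosDef}.indicator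
        (fun Y => F (sqNorm x * ((of Y)ᴴ * (1 : Matrix m m ℂ) * of Y).det.re,
          (1 - sqNorm x) * (1 - Sᴴ * S - (of Y)ᴴ * (1 : Matrix m m ℂ) * of Y).det.re)) Y := by
    intro Y
    rw [hgram]
    have hiff : of.symm (U * fromBlocks (diagonal fun _ => (ρ : ℂ)) ((σ : ℂ) • S) 0 (of Y)) ∈
        matrixBall (Unit ⊕ m) (Unit ⊕ q) ↔
        Y ∈ {Y : m → q → ℂ | (1 - Sᴴ * S - (of Y)ᴴ * (1 : Matrix m m ℂ) * of Y).PosDef} := by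
      rw [matrixBall, Set.mem_ofPred_eq, hUW, posDef_one_sub_gram_fromBlocks S (of Y) hsum hσ0,
        Set.mem_ofPred_eq, Matrix.mul_one]
    by_cases hY : Y ∈ {Y : m → q → ℂ | (1 - Sᴴ * S - (of Y)ᴴ * (1 : Matrix m m ℂ) * of Y).PosDef}
    · rw [Set.indicator_of_mem hY, Set.indicator_of_mem (hiff.2 hY), gramDets, hUW,
        det_gram_fromBlocks_re, det_one_sub_gram_fromBlocks_re S (of Y) hsum, hρ2, hσ2,
        Matrix.mul_one]
    · rw [Set.indicator_of_notMem hY, Set.indicator_of_notMem fun h => hY (hiff.1 h)]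
  refine (congrArg _ (funext hind)).trans ?_
  rw [lintegral_indicator]
  swap
  · have := continuous_matrix_of (m := m) (q := q)
    exact measurableSet_setOf_posDef (by fun_prop)
  by_cases hs : sqNorm s < 1
  · rw [Set.indicator_of_mem (show s ∈ {s | sqNorm s < 1} from hs)]
    have hC : (1 - Sᴴ * S).PosDef := (posDef_one_sub_replicateRow_iff s).2 hs
    have hF' : Measurable fun z : ℝ × ℝ => F (sqNorm x * z.1, (1 - sqNorm x) * z.2) :=
      hF.comp (by fun_prop)
    have := lintegral_ellipsoid (m := m) hC PosDef.one hF'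
    simp only at this
    rw [this, det_one_sub_replicateRow_re]
    simp
  · rw [Set.indicator_of_notMem (show s ∉ {s | sqNorm s < 1} from hs)]
    have : {Y : m → q → ℂ | (1 - Sᴴ * S - (of Y)ᴴ * (1 : Matrix m m ℂ) * of Y).PosDef} = ∅ := by
      ext Y
      simp only [Set.mem_ofPred_eq, Set.mem_empty_iff_false, iff_false, Matrix.mul_one]
      exact fun h => hs (sqNorm_lt_one_of_posDef s (of Y) h)
    rw [this]
    simp

theorem lintegral_gramLaw_sum {F : ℝ × ℝ → ℝ≥0∞} (hF : Measurable F) :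
    ∫⁻ z, F z ∂gramLaw (Unit ⊕ m) (Unit ⊕ q) =
      ∫⁻ x : Unit ⊕ m → ℂ in {x | sqNorm x < 1}, ENNReal.ofReal ((1 - sqNorm x) ^ Fintype.card q) *
        ∫⁻ s : q → ℂ in {s | sqNorm s < 1}, ENNReal.ofReal ((1 - sqNorm s) ^ Fintype.card m) *
          ∫⁻ z, F (sqNorm x * ((1 - sqNorm s) * z.1), (1 - sqNorm x) * ((1 - sqNorm s) * z.2))
            ∂gramLaw m q := by
  have hball : MeasurableSet (matrixBall (Unit ⊕ m) (Unit ⊕ q)) := measurableSet_matrixBall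
  rw [lintegral_gramLaw hF, ← lintegral_indicator hball,
    lintegral_pi_sum_elim_unit (G := (matrixBall (Unit ⊕ m) (Unit ⊕ q)).indicator
      fun X => F (gramDets X)) ((hF.comp measurable_gramDets).indicator hball),
    ← lintegral_indicator (measurableSet_lt measurable_sqNorm measurable_const)]
  refine lintegral_congr fun x => ?_
  by_cases hx : sqNorm x < 1
  · rw [Set.indicator_of_mem (show x ∈ {x | sqNorm x < 1} from hx)]
    exact lintegral_slice hF x hx
  · rw [Set.indicator_of_notMem (show x ∉ {x | sqNorm x < 1} from hx)]
    refine (lintegral_congr fun X => ?_).trans lintegral_zero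
    exact Set.indicator_of_notMem (fun h => hx (sqNorm_lt_one_of_mem_matrixBall x X h)) _

end Recursion

section Radial

/-- The multiplicative character `t ↦ |t| ^ a` of `ℝ`, with value `0` at `0`. -/
noncomputable def absCpow (a : ℂ) (t : ℝ) : ℂ := if t = 0 then 0 else ((|t| : ℝ) : ℂ) ^ a

theorem absCpow_mul (a : ℂ) (s t : ℝ) : absCpow a (s * t) = absCpow a s * absCpow a t := by
  unfold absCpow
  by_cases hs : s = 0
  · simp [hs]
  by_cases ht : t = 0
  · simp [ht]
  rw [if_neg hs, if_neg ht, if_neg (mul_ne_zero hs ht), abs_mul, Complex.ofReal_mul,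
    Complex.mul_cpow_ofReal_nonneg (abs_nonneg _) (abs_nonneg _)]

theorem absCpow_add (a b : ℂ) (t : ℝ) : absCpow (a + b) t = absCpow a t * absCpow b t := by
  unfold absCpow
  by_cases ht : t = 0
  · simp [ht]
  rw [if_neg ht, if_neg ht, if_neg ht, Complex.cpow_add _ _ (by simpa using ht)]

theorem absCpow_of_pos (a : ℂ) {t : ℝ} (ht : 0 < t) : absCpow a t = (t : ℂ) ^ a := by
  rw [absCpow, if_neg ht.ne', abs_of_pos ht]

@[simp] theorem absCpow_zero_right (a : ℂ) : absCpow a 0 = 0 := by simp [absCpow]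

@[simp] theorem absCpow_one_right (a : ℂ) : absCpow a 1 = 1 := by simp [absCpow]

theorem pow_mul_absCpow (a : ℂ) (N : ℕ) {t : ℝ} (ht : 0 < t) :
    (t : ℂ) ^ N * absCpow a t = absCpow (a + N) t := by
  rw [absCpow_add, absCpow_of_pos _ ht, absCpow_of_pos _ ht, Complex.cpow_natCast, mul_comm]

theorem measurable_absCpow (a : ℂ) : Measurable (absCpow a) := by
  unfold absCpow
  refine Measurable.ite (measurableSet_singleton 0) measurable_const ?_
  fun_prop

variable {ι : Type*} [Fintype ι]

theorem volume_real_sqNorm_lt_one :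
    (volume : Measure (ι → ℂ)).real {x | sqNorm x < 1} =
      Real.pi ^ Fintype.card ι / Real.Gamma (Fintype.card ι + 1) := by
  have h := Complex.volume_sum_rpow_lt_one ι (p := 2) (by norm_num)
  have h2 : {x : ι → ℂ | ∑ i, ‖x i‖ ^ (2 : ℝ) < 1} = {x | sqNorm x < 1} := by
    simp [sqNorm]
  rw [Measure.real, ← h2, h, ENNReal.toReal_ofReal]
  · norm_num [Real.Gamma_two]
  · have := Real.Gamma_pos_of_pos (s := 2 * Fintype.card ι / 2 + 1) (by positivity)
    have := Real.Gamma_pos_of_pos (s := 2 / 2 + 1) (by positivity)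
    positivity

theorem integral_sqNorm [Nonempty ι] (f : ℝ → ℂ) :
    ∫ x : ι → ℂ, f (sqNorm x) = (Real.pi ^ Fintype.card ι / Complex.Gamma (Fintype.card ι) : ℂ) *
      ∫ t in Set.Ioi (0 : ℝ), (t : ℂ) ^ (Fintype.card ι - 1) * f t := by
  let e := (PiLp.continuousLinearEquiv 2 ℝ (fun _ : ι => ℂ)).symm
  have hh : (volume : Measure (ι → ℂ)).IsAddHaarMeasure := Measure.pi.isAddHaarMeasure _
  set μ : Measure (EuclideanSpace ℂ ι) := (volume : Measure (ι → ℂ)).map e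
  have hμ : μ.IsAddHaarMeasure := e.isAddHaarMeasure_map volume
  have hnorm : ∀ x : ι → ℂ, ‖e x‖ ^ 2 = sqNorm x := fun x => EuclideanSpace.norm_sq_eq _
  have he : MeasurableEmbedding e := e.toHomeomorph.measurableEmbedding
  have h1 : ∫ x : ι → ℂ, f (sqNorm x) = ∫ y, f (‖y‖ ^ 2) ∂μ := by
    rw [he.integral_map]
    simp only [hnorm]
  have hdim : Module.finrank ℝ (EuclideanSpace ℂ ι) = 2 * Fintype.card ι := by
    rw [← LinearEquiv.finrank_eq e.toLinearEquiv, Module.finrank_pi_fintype]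
    simp [Complex.finrank_real_complex, mul_comm]
  have hball : μ.real (Metric.ball 0 1) =
      Real.pi ^ Fintype.card ι / Real.Gamma (Fintype.card ι + 1) := by
    rw [← volume_real_sqNorm_lt_one, Measure.real, Measure.real, he.map_apply]
    congr 2
    ext x
    rw [Set.mem_preimage, mem_ball_zero_iff, Set.mem_ofPred_eq, ← hnorm, sq_lt_one_iff₀ (norm_nonneg _)]
  rw [h1, integral_fun_norm_addHaar μ (fun r => f (r ^ 2)), hdim, hball,
    ← integral_comp_rpow_Ioi_of_pos
    (g := fun t : ℝ => (t : ℂ) ^ (Fintype.card ι - 1) * f t) (p := 2) (by norm_num)]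
  have hn : 0 < Fintype.card ι := Fintype.card_pos
  generalize Fintype.card ι = n at *
  have hG : Complex.Gamma n ≠ 0 := Complex.Gamma_ne_zero_of_re_pos (by simpa using hn)
  have hG' : (Real.Gamma (n + 1) : ℂ) = n * Complex.Gamma n := by
    rw [← Complex.ofReal_natCast, Complex.Gamma_ofReal, ← Complex.ofReal_mul,
      Real.Gamma_add_one (by positivity)]
  have hIoi : ∫ t in Set.Ioi (0 : ℝ), ((2 : ℝ) * t ^ ((2 : ℝ) - 1)) •
      (((t ^ (2 : ℝ) : ℝ) : ℂ) ^ (n - 1) * f (t ^ (2 : ℝ))) =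
      2 * ∫ y in Set.Ioi (0 : ℝ), y ^ (2 * n - 1) • f (y ^ 2) := by
    rw [← integral_const_mul]
    refine setIntegral_congr_fun measurableSet_Ioi fun t ht => ?_
    obtain ⟨k, rfl⟩ : ∃ k, n = k + 1 := ⟨n - 1, by omega⟩
    have h2 : 2 * (k + 1) - 1 = 2 * k + 1 := by omega
    have h3 : (2 : ℝ) - 1 = 1 := by norm_num
    simp only [h2, h3, Real.rpow_one, Real.rpow_two, Complex.real_smul, Nat.add_sub_cancel]
    push_cast
    ring
  rw [hIoi]
  simp only [Complex.real_smul, nsmul_eq_mul]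
  push_cast
  rw [hG']
  have : (n : ℂ) ≠ 0 := by exact_mod_cast hn.ne'
  field_simp

theorem integral_Ioi_eq_betaIntegral {a b : ℂ} (n : ℕ) (hn : 0 < n) :
    ∫ t in Set.Ioi (0 : ℝ), (t : ℂ) ^ (n - 1) *
      (Set.Iio (1 : ℝ)).indicator (fun t => absCpow a t * absCpow b (1 - t)) t =
    Complex.betaIntegral (a + n) (b + 1) := by
  rw [Complex.betaIntegral, intervalIntegral.integral_of_le zero_le_one,
    integral_Ioc_eq_integral_Ioo, ← Set.Ioi_inter_Iio, ← setIntegral_indicator measurableSet_Iio]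
  refine setIntegral_congr_fun measurableSet_Ioi fun t (ht : 0 < t) => ?_
  by_cases h : t < 1
  · simp only [Set.indicator_of_mem (show t ∈ Set.Iio 1 from h)]
    rw [← mul_assoc, pow_mul_absCpow _ _ ht, absCpow_of_pos _ ht, absCpow_of_pos _ (by linarith),
      Nat.cast_sub hn]
    push_cast
    ring_nf
  · simp only [Set.indicator_of_notMem (show t ∉ Set.Iio 1 from h), mul_zero]

theorem betaIntegral_eq_div {u v : ℂ} (hu : 0 < u.re) (hv : 0 < v.re) :
    Complex.betaIntegral u v = Complex.Gamma u * Complex.Gamma v / Complex.Gamma (u + v) := by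
  rw [Complex.Gamma_mul_Gamma_eq_betaIntegral hu hv, mul_div_cancel_left₀]
  exact Complex.Gamma_ne_zero_of_re_pos (by simpa using add_pos hu hv)

theorem integral_absCpow_sqNorm [Nonempty ι] {a b : ℂ} (ha : 0 < (a + Fintype.card ι).re)
    (hb : 0 < (b + 1).re) :
    ∫ x : ι → ℂ in {x | sqNorm x < 1}, absCpow a (sqNorm x) * absCpow b (1 - sqNorm x) =
      (Real.pi ^ Fintype.card ι / Complex.Gamma (Fintype.card ι) : ℂ) *
        (Complex.Gamma (a + Fintype.card ι) * Complex.Gamma (b + 1) /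
          Complex.Gamma (a + Fintype.card ι + (b + 1))) := by
  rw [← betaIntegral_eq_div ha hb, ← integral_Ioi_eq_betaIntegral _ Fintype.card_pos,
    ← integral_sqNorm, ← integral_indicator (measurableSet_lt measurable_sqNorm measurable_const)]
  rfl

theorem integral_absCpow_one_sub_sqNorm {c : ℂ} (hc : 0 < (c + 1).re) :
    ∫ x : ι → ℂ in {x | sqNorm x < 1}, absCpow c (1 - sqNorm x) =
      Real.pi ^ Fintype.card ι * (Complex.Gamma (c + 1) /
          Complex.Gamma (c + 1 + Fintype.card ι)) := by
  cases isEmpty_or_nonempty ι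
  · have h1 : ∀ x : ι → ℂ, sqNorm x = 0 := fun x => by simp [sqNorm]
    simp [h1, div_self (Complex.Gamma_ne_zero_of_re_pos hc), Measure.real]
    simp [volume_pi]
  · have hn : 0 < Fintype.card ι := Fintype.card_pos
    have hn' : 0 < ((0 : ℂ) + Fintype.card ι).re := by simpa using hn
    have hG : Complex.Gamma (Fintype.card ι) ≠ 0 :=
      Complex.Gamma_ne_zero_of_re_pos (by simpa using hn)
    have h := integral_sqNorm (ι := ι) ((Set.Iio (1 : ℝ)).indicator fun t => absCpow c (1 - t))
    have h2 : ∫ t in Set.Ioi (0 : ℝ), (t : ℂ) ^ (Fintype.card ι - 1) *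
        (Set.Iio (1 : ℝ)).indicator (fun t => absCpow c (1 - t)) t =
        Complex.betaIntegral (0 + Fintype.card ι) (c + 1) := by
      rw [← integral_Ioi_eq_betaIntegral _ hn]
      refine setIntegral_congr_fun measurableSet_Ioi fun t (ht : 0 < t) => ?_
      by_cases h : t < 1
      · simp [Set.indicator_of_mem (show t ∈ Set.Iio 1 from h), absCpow_of_pos _ ht]
      · simp [Set.indicator_of_notMem (show t ∉ Set.Iio 1 from h)]
    rw [h2, betaIntegral_eq_div hn' hc] at h
    rw [← integral_indicator (measurableSet_lt measurable_sqNorm measurable_const)]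
    refine h.trans ?_
    rw [zero_add, add_comm (Fintype.card ι : ℂ)]
    field_simp

end Radial

section SquareDirichlet

theorem Matrix.posDef_submatrix_equiv {q q' R : Type*} [Ring R] [PartialOrder R] [StarRing R]
    {M : Matrix q q R} (e : q' ≃ q) : (M.submatrix e e).PosDef ↔ M.PosDef :=
  ⟨fun h => by simpa using h.submatrix e.symm.injective, fun h => h.submatrix e.injective⟩

theorem gramLaw_congr {m m' q q' : Type*} [Fintype m] [Fintype m'] [Fintype q] [Fintype q']
    [DecidableEq q] [DecidableEq q'] (e : m ≃ m') (f : q ≃ q') : gramLaw m q = gramLaw m' q' := by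
  let φ : (m → q → ℂ) ≃ᵐ (m' → q' → ℂ) :=
    MeasurableEquiv.arrowCongr' e (MeasurableEquiv.arrowCongr' f (MeasurableEquiv.refl ℂ))
  have hφ : MeasurePreserving φ :=
    volume_preserving_arrowCongr' e _ (volume_preserving_arrowCongr' f _ (MeasurePreserving.id _))
  have hof : ∀ X, of (φ X) = (of X).submatrix e.symm f.symm := fun X => rfl
  have hgram : ∀ X, (of (φ X))ᴴ * of (φ X) = ((of X)ᴴ * of X).submatrix f.symm f.symm := by
    intro X
    rw [hof, conjTranspose_submatrix, submatrix_mul_equiv]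
  have hsub : ∀ X, 1 - (of (φ X))ᴴ * of (φ X) =
      (1 - (of X)ᴴ * of X).submatrix f.symm f.symm := by
    intro X
    rw [hgram]
    ext i j
    simp [Matrix.one_apply]
  have hdets : ∀ X, gramDets (φ X) = gramDets X := by
    intro X
    rw [gramDets, gramDets, hsub, hgram, det_submatrix_equiv_self, det_submatrix_equiv_self]
  have hball : φ ⁻¹' matrixBall m' q' = matrixBall m q := by
    ext X
    rw [Set.mem_preimage, matrixBall, Set.mem_ofPred_eq, hsub, Matrix.posDef_submatrix_equiv]
    rfl
  rw [gramLaw, gramLaw, ← (hφ.restrict_preimage measurableSet_matrixBall).map_eq, hball,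
    Measure.map_map measurable_gramDets φ.measurable]
  congr 1
  exact funext fun X => (hdets X).symm

/-- The law of the squared norm on the unit ball of `ℂ^ι`, weighted by `(1 - ‖x‖²) ^ N`. -/
noncomputable def radialLaw (ι : Type*) [Fintype ι] (N : ℕ) : Measure ℝ :=
  ((volume.restrict {x : ι → ℂ | sqNorm x < 1}).withDensity
    fun x => ENNReal.ofReal ((1 - sqNorm x) ^ N)).map sqNorm

variable {ι : Type*} [Fintype ι]

instance (N : ℕ) : SFinite (radialLaw ι N) := by unfold radialLaw; infer_instance

theorem measurable_radialWeight (N : ℕ) :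
    Measurable fun x : ι → ℂ => ENNReal.ofReal ((1 - sqNorm x) ^ N) := by
  have := measurable_sqNorm (m := ι)
  fun_prop

theorem lintegral_radialLaw (N : ℕ) {f : ℝ → ℝ≥0∞} (hf : Measurable f) :
    ∫⁻ t, f t ∂radialLaw ι N =
      ∫⁻ x : ι → ℂ in {x | sqNorm x < 1}, ENNReal.ofReal ((1 - sqNorm x) ^ N) * f (sqNorm x) := by
  rw [radialLaw, lintegral_map hf measurable_sqNorm]
  exact lintegral_withDensity_eq_lintegral_mul _ (measurable_radialWeight N)
    (hf.comp measurable_sqNorm)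

theorem integral_radialLaw (N : ℕ) {f : ℝ → ℂ} (hf : Measurable f) :
    ∫ t, f t ∂radialLaw ι N =
      ∫ x : ι → ℂ in {x | sqNorm x < 1}, ((1 - sqNorm x : ℝ) : ℂ) ^ N * f (sqNorm x) := by
  rw [radialLaw, integral_map measurable_sqNorm.aemeasurable hf.aestronglyMeasurable,
    integral_withDensity_eq_integral_toReal_smul (measurable_radialWeight N)
      (ae_of_all _ fun _ => ENNReal.ofReal_lt_top)]
  refine setIntegral_congr_fun (measurableSet_lt measurable_sqNorm measurable_const)
    fun x (hx : sqNorm x < 1) => ?_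
  simp only [Complex.real_smul]
  rw [ENNReal.toReal_ofReal (pow_nonneg (by linarith) _), Complex.ofReal_pow]

theorem gramLaw_sum {m q : Type*} [Fintype m] [Fintype q] [DecidableEq m] [DecidableEq q] :
    gramLaw (Unit ⊕ m) (Unit ⊕ q) =
      ((radialLaw (Unit ⊕ m) (Fintype.card q)).prod
        ((radialLaw q (Fintype.card m)).prod (gramLaw m q))).map
      fun w => (w.1 * ((1 - w.2.1) * w.2.2.1), (1 - w.1) * ((1 - w.2.1) * w.2.2.2)) := by
  have hΦ : Measurable fun w : ℝ × ℝ × ℝ × ℝ =>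
      (w.1 * ((1 - w.2.1) * w.2.2.1), (1 - w.1) * ((1 - w.2.1) * w.2.2.2)) := by fun_prop
  refine Measure.ext_of_lintegral _ fun F hF => ?_
  have h1 : Measurable fun w : ℝ × ℝ × ℝ × ℝ =>
      F (w.1 * ((1 - w.2.1) * w.2.2.1), (1 - w.1) * ((1 - w.2.1) * w.2.2.2)) := hF.comp hΦ
  rw [lintegral_gramLaw_sum hF, lintegral_map hF hΦ, lintegral_prod _ h1.aemeasurable,
    lintegral_radialLaw _ h1.lintegral_prod_right']
  refine lintegral_congr fun x => ?_
  congr 1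
  have h2 : Measurable fun w : ℝ × ℝ × ℝ =>
      F (sqNorm x * ((1 - w.1) * w.2.1), (1 - sqNorm x) * ((1 - w.1) * w.2.2)) :=
    hF.comp (by fun_prop)
  rw [lintegral_prod _ h2.aemeasurable, lintegral_radialLaw _ h2.lintegral_prod_right']

theorem cGammaP_succ (p : ℕ) (z : ℂ) :
    cGammaP (p + 1) (z + 1) = (Real.pi : ℂ) ^ p * Complex.Gamma (z + 1) * cGammaP p z := by
  have h : (p + 1) * (p + 1 - 1) / 2 = p + p * (p - 1) / 2 := by
    rw [Nat.add_sub_cancel]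
    rcases p with _ | p
    · rfl
    · rw [Nat.add_sub_cancel, ← Nat.mul_add_div two_pos]
      congr 1
      ring
  rw [cGammaP, cGammaP, h, pow_add, Fin.prod_univ_succ]
  simp only [Fin.val_zero, Fin.val_succ, Nat.cast_zero, sub_zero, Nat.cast_add, Nat.cast_one,
    add_sub_add_right_eq_sub]
  ring

theorem cGammaP_ne_zero {p : ℕ} {z : ℂ} (hz : (p - 1 : ℝ) < z.re) : cGammaP p z ≠ 0 := by
  rw [cGammaP]
  refine mul_ne_zero (pow_ne_zero _ (by simp [Real.pi_ne_zero])) (Finset.prod_ne_zero_iff.2 ?_)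
  intro j _
  apply Complex.Gamma_ne_zero_of_re_pos
  have : (j : ℝ) + 1 ≤ p := by exact_mod_cast j.2
  simp only [Complex.sub_re, Complex.natCast_re]
  linarith

theorem cGammaP_add_one (p : ℕ) (z : ℂ) :
    cGammaP p (z + 1) * Complex.Gamma (z + 1 - p) = Complex.Gamma (z + 1) * cGammaP p z := by
  have h := Fin.prod_univ_succ fun j : Fin (p + 1) => Complex.Gamma (z + 1 - j)
  rw [Fin.prod_univ_castSucc] at h
  simp only [Fin.val_zero, Fin.val_succ, Nat.cast_zero, sub_zero, Nat.cast_add, Nat.cast_one,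
    add_sub_add_right_eq_sub, Fin.val_castSucc, Fin.val_last] at h
  rw [cGammaP, cGammaP, mul_assoc, h]
  ring

theorem integral_absCpow_radialLaw [Nonempty ι] {a b : ℂ} (N : ℕ)
    (ha : 0 < (a + Fintype.card ι).re) (hb : 0 < (b + N + 1).re) :
    ∫ t, absCpow a t * absCpow b (1 - t) ∂radialLaw ι N =
      (Real.pi ^ Fintype.card ι / Complex.Gamma (Fintype.card ι) : ℂ) *
        (Complex.Gamma (a + Fintype.card ι) * Complex.Gamma (b + N + 1) /
          Complex.Gamma (a + Fintype.card ι + (b + N + 1))) := by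
  have hm : Measurable fun t => absCpow a t * absCpow b (1 - t) :=
    (measurable_absCpow a).mul ((measurable_absCpow b).comp (by fun_prop))
  rw [← integral_absCpow_sqNorm ha hb, integral_radialLaw N hm]
  refine setIntegral_congr_fun (measurableSet_lt measurable_sqNorm measurable_const)
    fun x (hx : sqNorm x < 1) => ?_
  rw [← pow_mul_absCpow b N (by linarith)]
  ring

theorem integral_absCpow_one_sub_radialLaw {c : ℂ} (N : ℕ) (hc : 0 < (c + N + 1).re) :
    ∫ t, absCpow c (1 - t) ∂radialLaw ι N =
      Real.pi ^ Fintype.card ι * (Complex.Gamma (c + N + 1) /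
          Complex.Gamma (c + N + 1 + Fintype.card ι)) := by
  have hm : Measurable fun t => absCpow c (1 - t) := (measurable_absCpow c).comp (by fun_prop)
  rw [← integral_absCpow_one_sub_sqNorm hc, integral_radialLaw N hm]
  refine setIntegral_congr_fun (measurableSet_lt measurable_sqNorm measurable_const)
    fun x (hx : sqNorm x < 1) => ?_
  rw [← pow_mul_absCpow c N (by linarith)]

theorem integral_absCpow_one_sub_radialLaw_of_isEmpty [IsEmpty ι] {c : ℂ} (N : ℕ) :
    ∫ t, absCpow c (1 - t) ∂radialLaw ι N = 1 := by
  have hm : Measurable fun t => absCpow c (1 - t) := (measurable_absCpow c).comp (by fun_prop)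
  have h1 : ∀ x : ι → ℂ, sqNorm x = 0 := fun x => by simp [sqNorm]
  rw [integral_radialLaw N hm]
  simp [h1, Measure.real, volume_pi]

theorem integral_gramLaw_of_isEmpty {m q : Type*} [Fintype m] [Fintype q] [DecidableEq q]
    [IsEmpty q] {f : ℝ × ℝ → ℂ} (hf : Measurable f) : ∫ z, f z ∂gramLaw m q = f (1, 1) := by
  have hball : matrixBall m q = Set.univ := by
    ext X
    simp only [Set.mem_univ, iff_true]
    change Matrix.PosDef _
    rw [Subsingleton.elim (1 - (of X)ᴴ * of X) 1]
    exact PosDef.one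
  have h1 : ∀ X : m → q → ℂ, gramDets X = (1, 1) := fun X => by simp [gramDets]
  rw [gramLaw, integral_map measurable_gramDets.aemeasurable hf.aestronglyMeasurable, hball]
  simp [h1, Measure.real, volume_pi, Measure.pi_univ]

theorem measurable_absCpow_mul (a b : ℂ) :
    Measurable fun z : ℝ × ℝ => absCpow a z.1 * absCpow b z.2 :=
  ((measurable_absCpow a).comp measurable_fst).mul ((measurable_absCpow b).comp measurable_snd)

theorem integral_gramLaw (p n : ℕ) (hpn : p ≤ n) (a b : ℂ) (ha : (p - 1 : ℝ) < (a + n).re)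
    (hb : -1 < b.re) :
    ∫ z, absCpow a z.1 * absCpow b z.2 ∂gramLaw (Fin n) (Fin p) =
      (Real.pi : ℂ) ^ (n * p) / cGammaP p n * cGammaP p (a + n) * cGammaP p (b + p) /
        cGammaP p (a + n + (b + p)) := by
  induction p generalizing n with
  | zero =>
    rw [integral_gramLaw_of_isEmpty (measurable_absCpow_mul a b)]
    simp [cGammaP]
  | succ p ih =>
    obtain ⟨n, rfl⟩ : ∃ k, n = k + 1 := ⟨n - 1, by omega⟩
    have hpn' : p ≤ n := by omega
    push_cast at ha
    simp only [Complex.add_re, Complex.one_re, Complex.natCast_re] at ha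
    have hpn_real : (p : ℝ) ≤ n := by exact_mod_cast hpn'
    have hp0 : (0 : ℝ) ≤ p := Nat.cast_nonneg p
    have ih' := ih n hpn' (by simp; linarith)
    have he1 : Fin (n + 1) ≃ Unit ⊕ Fin n :=
      Fintype.equivOfCardEq (by simp [add_comm])
    have he2 : Fin (p + 1) ≃ Unit ⊕ Fin p :=
      Fintype.equivOfCardEq (by simp [add_comm])
    have hΦ : Measurable fun w : ℝ × ℝ × ℝ × ℝ =>
      (w.1 * ((1 - w.2.1) * w.2.2.1), (1 - w.1) * ((1 - w.2.1) * w.2.2.2)) := by fun_prop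
    rw [gramLaw_congr he1 he2, gramLaw_sum, integral_map hΦ.aemeasurable
      (measurable_absCpow_mul a b).aestronglyMeasurable]
    have hsplit : ∀ w : ℝ × ℝ × ℝ × ℝ, absCpow a (w.1 * ((1 - w.2.1) * w.2.2.1)) *
        absCpow b ((1 - w.1) * ((1 - w.2.1) * w.2.2.2)) =
        (absCpow a w.1 * absCpow b (1 - w.1)) *
          (fun v : ℝ × ℝ × ℝ => absCpow (a + b) (1 - v.1) *
            (absCpow a v.2.1 * absCpow b v.2.2)) w.2 := by
      intro w
      simp only [absCpow_mul, absCpow_add]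
      ring
    simp only [hsplit]
    rw [integral_prod_mul (fun t => absCpow a t * absCpow b (1 - t))
        (fun v : ℝ × ℝ × ℝ => absCpow (a + b) (1 - v.1) *
            (absCpow a v.2.1 * absCpow b v.2.2)),
      integral_prod_mul (fun t => absCpow (a + b) (1 - t))
        (fun z : ℝ × ℝ => absCpow a z.1 * absCpow b z.2), ih',
      integral_absCpow_radialLaw]
    rotate_left
    · simp; linarith
    · simp; linarith
    set z := a + n + (b + p) with hz
    have hzre : (p - 1 : ℝ) + (p - 1) < z.re := by simp [hz]; linarith
    have hz1 : cGammaP p (z + 1) ≠ 0 := cGammaP_ne_zero (by simp; linarith)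
    have hR : ∫ t, absCpow (a + b) (1 - t) ∂radialLaw (Fin p) (Fintype.card (Fin n)) =
        (Real.pi : ℂ) ^ p * (cGammaP p z / cGammaP p (z + 1)) := by
      rcases Nat.eq_zero_or_pos p with rfl | hp
      · rw [integral_absCpow_one_sub_radialLaw_of_isEmpty]
        simp [cGammaP]
      · have hp1 : (1 : ℝ) ≤ p := by exact_mod_cast hp
        have hg : Complex.Gamma (z + 1) ≠ 0 :=
          Complex.Gamma_ne_zero_of_re_pos (by simp; linarith)
        have hq := cGammaP_add_one p z
        have hzp : z + 1 - p = a + b + n + 1 := by rw [hz]; ring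
        have hzp' : a + b + n + 1 + p = z + 1 := by rw [hz]; ring
        rw [integral_absCpow_one_sub_radialLaw, Fintype.card_fin, Fintype.card_fin, hzp']
        · rw [hzp] at hq
          congr 1
          rw [div_eq_div_iff hg hz1]
          linear_combination hq
        · simp; linarith
    rw [hR]
    simp only [Fintype.card_sum, Fintype.card_fin, Fintype.card_unit]
    push_cast
    have e1 : a + (n + 1) = (a + n) + 1 := by ring
    have e2 : b + (p + 1) = (b + p) + 1 := by ring
    have e3 : a + n + 1 + (b + p + 1) = (z + 1) + 1 := by rw [hz]; ring
    have hz0 : cGammaP p z ≠ 0 := by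
      rcases Nat.eq_zero_or_pos p with rfl | hp
      · simp [cGammaP]
      · have hp1 : (1 : ℝ) ≤ p := by exact_mod_cast hp
        exact cGammaP_ne_zero (by linarith)
    have hpi : (Real.pi : ℂ) ≠ 0 := by simp [Real.pi_ne_zero]
    rw [add_comm 1 (n : ℂ), e1, e2, e3, cGammaP_succ, cGammaP_succ, cGammaP_succ, cGammaP_succ]
    field_simp
    ring

end SquareDirichlet

section DirichletLaw

variable {k : ℕ} {q : Type*} [Fintype q] [DecidableEq q]

/-- The sum of the weighted Gram matrices `X_j* B_j X_j`. -/
def weightedGramSum {n : Fin k → ℕ} (B : (j : Fin k) → Matrix (Fin (n j)) (Fin (n j)) ℂ)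
    (X : (j : Fin k) → Fin (n j) → q → ℂ) : Matrix q q ℂ :=
  ∑ j, (of (X j))ᴴ * B j * of (X j)

/-- The determinants of the weighted Gram matrices and of the complement of their sum. -/
noncomputable def dirichletDets {n : Fin k → ℕ}
    (B : (j : Fin k) → Matrix (Fin (n j)) (Fin (n j)) ℂ)
    (X : (j : Fin k) → Fin (n j) → q → ℂ) : (Fin k → ℝ) × ℝ :=
  (fun j => ((of (X j))ᴴ * B j * of (X j)).det.re, (1 - weightedGramSum B X).det.re)

/-- The region where the complement of the sum of the weighted Gram matrices is positive
definite. -/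
def dirichletRegion {n : Fin k → ℕ} (q : Type*) [Fintype q] [DecidableEq q]
    (B : (j : Fin k) → Matrix (Fin (n j)) (Fin (n j)) ℂ) :
    Set ((j : Fin k) → Fin (n j) → q → ℂ) :=
  {X | (1 - weightedGramSum B X).PosDef}

/-- The image of Lebesgue measure on `dirichletRegion` under `dirichletDets`. -/
noncomputable def dirichletLaw {n : Fin k → ℕ} (q : Type*) [Fintype q] [DecidableEq q]
    (B : (j : Fin k) → Matrix (Fin (n j)) (Fin (n j)) ℂ) : Measure ((Fin k → ℝ) × ℝ) :=
  (volume.restrict (dirichletRegion q B)).map (dirichletDets B)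

variable {n : Fin k → ℕ} (B : (j : Fin k) → Matrix (Fin (n j)) (Fin (n j)) ℂ)

instance : SFinite (dirichletLaw q B) := by unfold dirichletLaw; infer_instance

omit [Fintype q] [DecidableEq q] in
theorem continuous_weightedGram (j : Fin k) :
    Continuous fun X : (j : Fin k) → Fin (n j) → q → ℂ => (of (X j))ᴴ * B j * of (X j) := by
  have h : Continuous fun X : (j : Fin k) → Fin (n j) → q → ℂ => of (X j) :=
    continuous_matrix_of.comp (continuous_apply j)
  fun_prop

omit [Fintype q] [DecidableEq q] in
theorem continuous_weightedGramSum :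
    Continuous (weightedGramSum B : ((j : Fin k) → Fin (n j) → q → ℂ) → Matrix q q ℂ) :=
  continuous_finsetSum _ fun j _ => continuous_weightedGram B j

theorem measurable_dirichletDets :
    Measurable (dirichletDets B : ((j : Fin k) → Fin (n j) → q → ℂ) → _) := by
  have h := continuous_weightedGram (q := q) B
  have h' := continuous_weightedGramSum (q := q) B
  unfold dirichletDets
  exact Continuous.measurable (by fun_prop)

theorem measurableSet_dirichletRegion : MeasurableSet (dirichletRegion q B) := by
  have h' := continuous_weightedGramSum (q := q) B
  exact measurableSet_setOf_posDef (by fun_prop)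

theorem ae_dirichletLaw_snd_pos : ∀ᵐ w ∂dirichletLaw q B, 0 < w.2 := by
  rw [dirichletLaw, ae_map_iff (measurable_dirichletDets B).aemeasurable
    (measurableSet_lt measurable_const measurable_snd)]
  refine ae_restrict_of_forall_mem (measurableSet_dirichletRegion B) fun X hX => ?_
  exact (Complex.lt_def.1 (PosDef.det_pos (A := 1 - weightedGramSum B X) hX)).1

theorem dirichletLaw_zero {n : Fin 0 → ℕ} (B : (j : Fin 0) → Matrix (Fin (n j)) (Fin (n j)) ℂ) :
    dirichletLaw q B = Measure.dirac (Fin.elim0, 1) := by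
  have hsum : ∀ X : (j : Fin 0) → Fin (n j) → q → ℂ, weightedGramSum B X = 0 := fun X => by
    simp [weightedGramSum]
  have hreg : dirichletRegion q B = Set.univ := by
    ext X
    simp only [Set.mem_univ, iff_true]
    change Matrix.PosDef _
    rw [hsum, sub_zero]
    exact PosDef.one
  have hdets : dirichletDets (q := q) B = fun _ => (Fin.elim0, 1) := by
    funext X
    refine Prod.ext (Subsingleton.elim _ _) ?_
    simp [dirichletDets, hsum]
  rw [dirichletLaw, hreg, hdets, Measure.restrict_univ, Measure.map_const]
  simp [volume_pi]

section Succ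

theorem measurable_insertNth_zero : Measurable fun v : ℝ × (Fin k → ℝ) =>
    (Fin.insertNth (α := fun _ => ℝ) 0 v.1 v.2 : Fin (k + 1) → ℝ) :=
  (MeasurableEquiv.piFinSuccAbove (fun _ : Fin (k + 1) => ℝ) 0).symm.measurable

theorem measurable_insertNth_mul : Measurable fun v : ((Fin k → ℝ) × ℝ) × ℝ × ℝ =>
    ((Fin.insertNth (α := fun _ => ℝ) 0 (v.1.2 * v.2.1) v.1.1 : Fin (k + 1) → ℝ),
      v.1.2 * v.2.2) := by
  refine Measurable.prodMk ?_ (by fun_prop)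
  exact measurable_insertNth_zero.comp
    (f := fun v : ((Fin k → ℝ) × ℝ) × ℝ × ℝ => (v.1.2 * v.2.1, v.1.1)) (by fun_prop)

variable {n : Fin (k + 1) → ℕ} {B : (j : Fin (k + 1)) → Matrix (Fin (n j)) (Fin (n j)) ℂ}

omit [Fintype q] [DecidableEq q] in
theorem weightedGramSum_insertNth (x : Fin (n 0) → q → ℂ)
    (Y : (j : Fin k) → Fin (n ((0 : Fin (k + 1)).succAbove j)) → q → ℂ) :
    weightedGramSum B (Fin.insertNth (α := fun j => Fin (n j) → q → ℂ) 0 x Y) =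
      (of x)ᴴ * B 0 * of x + weightedGramSum (fun j => B ((0 : Fin (k + 1)).succAbove j)) Y := by
  rw [weightedGramSum, Fin.sum_univ_succAbove _ 0]
  simp only [Fin.insertNth_apply_same, Fin.insertNth_apply_succAbove]
  rfl

theorem lintegral_dirichletLaw_succ (hB : ∀ j, (B j).PosDef)
    {F : (Fin (k + 1) → ℝ) × ℝ → ℝ≥0∞} (hF : Measurable F) :
    ∫⁻ w, F w ∂dirichletLaw q B = ENNReal.ofReal ((B 0).det.re ^ Fintype.card q)⁻¹ *
      ∫⁻ w, ENNReal.ofReal (w.2 ^ n 0) *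
        (∫⁻ z, F (Fin.insertNth (α := fun _ => ℝ) 0 (w.2 * z.1) w.1, w.2 * z.2)
        ∂gramLaw (Fin (n 0)) q) ∂dirichletLaw q fun j => B ((0 : Fin (k + 1)).succAbove j) := by
  set B' := fun j => B ((0 : Fin (k + 1)).succAbove j) with hB'
  have hmeas : Measurable fun v : ((Fin k → ℝ) × ℝ) × ℝ × ℝ =>
      F (Fin.insertNth (α := fun _ => ℝ) 0 (v.1.2 * v.2.1) v.1.1, v.1.2 * v.2.2) :=
    hF.comp measurable_insertNth_mul
  have hw : Measurable fun w : (Fin k → ℝ) × ℝ => ENNReal.ofReal (w.2 ^ n 0) := by fun_prop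
  have hH : Measurable fun w : (Fin k → ℝ) × ℝ => ENNReal.ofReal (w.2 ^ n 0) *
        (∫⁻ z, F (Fin.insertNth (α := fun _ => ℝ) 0 (w.2 * z.1) w.1, w.2 * z.2)
        ∂gramLaw (Fin (n 0)) q) :=
    hw.mul (hmeas.lintegral_prod_right' (ν := gramLaw (Fin (n 0)) q))
  have hG := (hF.comp (measurable_dirichletDets (q := q) B)).indicator
    (measurableSet_dirichletRegion B)
  have hp := volume_preserving_piFinSuccAbove (fun j : Fin (k + 1) => Fin (n j) → q → ℂ) 0
  rw [dirichletLaw, lintegral_map hF (measurable_dirichletDets B),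
    ← lintegral_indicator (measurableSet_dirichletRegion B)]
  refine (hp.symm.lintegral_comp hG).symm.trans ?_
  have hG' := hG.comp
    (MeasurableEquiv.piFinSuccAbove (fun j : Fin (k + 1) => Fin (n j) → q → ℂ) 0).symm.measurable
  refine (lintegral_prod_symm _ hG'.aemeasurable).trans ?_
  rw [dirichletLaw, lintegral_map hH (measurable_dirichletDets B'),
    ← lintegral_indicator (measurableSet_dirichletRegion B')]
  refine Eq.trans ?_ (lintegral_const_mul _
    ((hH.comp (measurable_dirichletDets B')).indicator (measurableSet_dirichletRegion B')))
  refine lintegral_congr fun Y => ?_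
  set C := 1 - weightedGramSum B' Y with hC
  have hof := continuous_matrix_of (m := Fin (n 0)) (q := q)
  have hS : MeasurableSet {x : Fin (n 0) → q → ℂ | (C - (of x)ᴴ * B 0 * of x).PosDef} :=
    measurableSet_setOf_posDef (by fun_prop)
  have hsub : ∀ x : Fin (n 0) → q → ℂ,
      1 - weightedGramSum B (Fin.insertNth (α := fun j => Fin (n j) → q → ℂ) 0 x Y) =
        C - (of x)ᴴ * B 0 * of x := fun x => by
    rw [weightedGramSum_insertNth, hC]
    abel
  have hdets : ∀ x : Fin (n 0) → q → ℂ,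
      dirichletDets B (Fin.insertNth (α := fun j => Fin (n j) → q → ℂ) 0 x Y) =
        (Fin.insertNth (α := fun _ => ℝ) 0 (((of x)ᴴ * B 0 * of x).det.re)
          (dirichletDets B' Y).1, (C - (of x)ᴴ * B 0 * of x).det.re) := fun x => by
    refine Prod.ext (funext fun j => ?_) (by rw [← hsub]; rfl)
    refine Fin.succAboveCases (0 : Fin (k + 1)) ?_ (fun i => ?_) j
    · simp [dirichletDets]
    · simp only [dirichletDets, hB', Fin.insertNth_apply_succAbove]
  have hleft : ∀ x : Fin (n 0) → q → ℂ,
      (dirichletRegion q B).indicator (F ∘ dirichletDets B)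
        (Fin.insertNth (α := fun j => Fin (n j) → q → ℂ) 0 x Y) =
      {x : Fin (n 0) → q → ℂ | (C - (of x)ᴴ * B 0 * of x).PosDef}.indicator
        (fun x => F (Fin.insertNth (α := fun _ => ℝ) 0 (((of x)ᴴ * B 0 * of x).det.re)
          (dirichletDets B' Y).1, (C - (of x)ᴴ * B 0 * of x).det.re)) x := fun x => by
    by_cases hx : (C - (of x)ᴴ * B 0 * of x).PosDef
    · rw [Set.indicator_of_mem, Set.indicator_of_mem, Function.comp_apply, hdets]
      · exact hx
      · rw [dirichletRegion, Set.mem_ofPred_eq, hsub]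
        exact hx
    · rw [Set.indicator_of_notMem, Set.indicator_of_notMem]
      · exact hx
      · rw [dirichletRegion, Set.mem_ofPred_eq, hsub]
        exact hx
  refine (lintegral_congr hleft).trans ?_
  rw [lintegral_indicator hS]
  by_cases hCp : C.PosDef
  · have hF' : Measurable fun z : ℝ × ℝ =>
        F (Fin.insertNth (α := fun _ => ℝ) 0 z.1 (dirichletDets B' Y).1, z.2) := by
      refine hF.comp (Measurable.prodMk ?_ measurable_snd)
      exact measurable_insertNth_zero.comp
        (f := fun z : ℝ × ℝ => (z.1, (dirichletDets B' Y).1)) (by fun_prop)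
    rw [Set.indicator_of_mem (show Y ∈ dirichletRegion q B' from hCp),
      lintegral_ellipsoid hCp (hB 0) hF', Fintype.card_fin, ENNReal.ofReal_mul, mul_assoc]
    · rfl
    · have := (Complex.lt_def.1 (hB 0).det_pos).1
      exact inv_nonneg.2 (pow_nonneg this.le _)
  · rw [Set.indicator_of_notMem (show Y ∉ dirichletRegion q B' from hCp), mul_zero]
    have hempty : {x : Fin (n 0) → q → ℂ | (C - (of x)ᴴ * B 0 * of x).PosDef} = ∅ := by
      refine Set.eq_empty_of_forall_notMem fun x hx => hCp ?_
      have := PosDef.add_posSemidef (A := C - (of x)ᴴ * B 0 * of x) hx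
        ((hB 0).posSemidef.conjTranspose_mul_mul_same (of x))
      rwa [sub_add_cancel] at this
    rw [hempty, Measure.restrict_empty, lintegral_zero_measure]

end Succ

end DirichletLaw

section DirichletIntegral

variable {k : ℕ}

theorem measurable_prod_absCpow (α : Fin k → ℂ) (b : ℂ) :
    Measurable fun w : (Fin k → ℝ) × ℝ => (∏ j, absCpow (α j) (w.1 j)) * absCpow b w.2 := by
  refine Measurable.mul (Finset.measurable_fun_prod _ fun j _ => ?_)
    ((measurable_absCpow b).comp measurable_snd)
  exact (measurable_absCpow (α j)).comp (by fun_prop)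

theorem dirichletLaw_succ {q : Type*} [Fintype q] [DecidableEq q] {n : Fin (k + 1) → ℕ}
    {B : (j : Fin (k + 1)) → Matrix (Fin (n j)) (Fin (n j)) ℂ} (hB : ∀ j, (B j).PosDef) :
    dirichletLaw q B = ENNReal.ofReal ((B 0).det.re ^ Fintype.card q)⁻¹ •
      (((dirichletLaw q fun j => B ((0 : Fin (k + 1)).succAbove j)).withDensity
        fun w => ENNReal.ofReal (w.2 ^ n 0)).prod (gramLaw (Fin (n 0)) q)).map
        fun v => (Fin.insertNth (α := fun _ => ℝ) 0 (v.1.2 * v.2.1) v.1.1, v.1.2 * v.2.2) := by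
  have hΦ : Measurable fun v : ((Fin k → ℝ) × ℝ) × ℝ × ℝ =>
      ((Fin.insertNth (α := fun _ => ℝ) 0 (v.1.2 * v.2.1) v.1.1 : Fin (k + 1) → ℝ),
        v.1.2 * v.2.2) := measurable_insertNth_mul
  refine Measure.ext_of_lintegral _ fun F hF => ?_
  have h1 : Measurable fun v : ((Fin k → ℝ) × ℝ) × ℝ × ℝ =>
      F (Fin.insertNth (α := fun _ => ℝ) 0 (v.1.2 * v.2.1) v.1.1, v.1.2 * v.2.2) := hF.comp hΦ
  rw [lintegral_dirichletLaw_succ hB hF, lintegral_smul_measure, lintegral_map hF hΦ,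
    lintegral_prod _ h1.aemeasurable, smul_eq_mul]
  congr 1
  refine (lintegral_withDensity_eq_lintegral_mul _ ?_ h1.lintegral_prod_right').symm
  fun_prop

theorem integral_dirichletLaw (p k : ℕ) (hp : 1 ≤ p) (n : Fin k → ℕ) (hn : ∀ j, p ≤ n j)
    (B : (j : Fin k) → Matrix (Fin (n j)) (Fin (n j)) ℂ) (hB : ∀ j, (B j).PosDef)
    (α : Fin k → ℂ) (b : ℂ) (hα : ∀ j, (p - 1 : ℝ) < (α j + n j).re) (hb : -1 < b.re) :
    ∫ w, (∏ j, absCpow (α j) (w.1 j)) * absCpow b w.2 ∂dirichletLaw (Fin p) B =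
      (∏ j, ((((B j).det.re : ℂ) ^ p)⁻¹ * ((Real.pi : ℂ) ^ (n j * p) / cGammaP p (n j)) *
        cGammaP p (α j + n j))) * cGammaP p (b + p) / cGammaP p (b + p + ∑ j, (α j + n j)) := by
  have hp1 : (1 : ℝ) ≤ p := by exact_mod_cast hp
  induction k generalizing b with
  | zero =>
    have hne : cGammaP p (b + p) ≠ 0 := cGammaP_ne_zero (by simp; linarith)
    rw [dirichletLaw_zero, integral_dirac]
    simp [hne]
  | succ k ih =>
    have h0 := hα 0
    simp only [Complex.add_re, Complex.natCast_re] at h0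
    have ih' := ih (fun j => n ((0 : Fin (k + 1)).succAbove j)) (fun j => hn _)
      (fun j => B ((0 : Fin (k + 1)).succAbove j)) (fun j => hB _)
      (fun j => α ((0 : Fin (k + 1)).succAbove j)) (b + α 0 + n 0) (fun j => hα _)
      (by simp; linarith)
    have hdet : 0 ≤ ((B 0).det.re ^ Fintype.card (Fin p))⁻¹ :=
      inv_nonneg.2 (pow_nonneg (Complex.lt_def.1 (hB 0).det_pos).1.le _)
    have hsplit : ∀ v : ((Fin k → ℝ) × ℝ) × ℝ × ℝ,
        (∏ j, absCpow (α j)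
          ((Fin.insertNth (α := fun _ => ℝ) 0 (v.1.2 * v.2.1) v.1.1 : Fin (k + 1) → ℝ) j)) *
            absCpow b (v.1.2 * v.2.2) =
        (fun w : (Fin k → ℝ) × ℝ => (∏ j, absCpow (α ((0 : Fin (k + 1)).succAbove j)) (w.1 j)) *
          absCpow (b + α 0) w.2) v.1 *
          (fun z : ℝ × ℝ => absCpow (α 0) z.1 * absCpow b z.2) v.2 := by
      intro v
      rw [Fin.prod_univ_succAbove _ 0]
      simp only [Fin.insertNth_apply_same, Fin.insertNth_apply_succAbove, absCpow_mul, absCpow_add]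
      ring
    have hweight : ∫ w : (Fin k → ℝ) × ℝ,
        (∏ j, absCpow (α ((0 : Fin (k + 1)).succAbove j)) (w.1 j)) * absCpow (b + α 0) w.2
          ∂((dirichletLaw (Fin p) fun j => B ((0 : Fin (k + 1)).succAbove j)).withDensity
            fun w => ENNReal.ofReal (w.2 ^ n 0)) =
        ∫ w, (∏ j, absCpow (α ((0 : Fin (k + 1)).succAbove j)) (w.1 j)) *
          absCpow (b + α 0 + n 0) w.2
          ∂dirichletLaw (Fin p) fun j => B ((0 : Fin (k + 1)).succAbove j) := by
      rw [integral_withDensity_eq_integral_toReal_smul (by fun_prop)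
        (ae_of_all _ fun _ => ENNReal.ofReal_lt_top)]
      refine integral_congr_ae ?_
      filter_upwards [ae_dirichletLaw_snd_pos _] with w hw
      rw [ENNReal.toReal_ofReal (pow_nonneg hw.le _), Complex.real_smul, Complex.ofReal_pow,
        ← pow_mul_absCpow _ _ hw]
      ring
    rw [dirichletLaw_succ hB, integral_smul_measure,
      integral_map measurable_insertNth_mul.aemeasurable
        (measurable_prod_absCpow α b).aestronglyMeasurable]
    simp only [hsplit]
    rw [integral_prod_mul (fun w : (Fin k → ℝ) × ℝ =>
        (∏ j, absCpow (α ((0 : Fin (k + 1)).succAbove j)) (w.1 j)) * absCpow (b + α 0) w.2)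
        (fun z : ℝ × ℝ => absCpow (α 0) z.1 * absCpow b z.2), hweight, ih',
      integral_gramLaw p (n 0) (hn 0) _ _ (hα 0) hb, ENNReal.toReal_ofReal hdet,
      Complex.real_smul, Fin.prod_univ_succAbove _ 0, Fin.sum_univ_succAbove _ 0, Fintype.card_fin]
    have e1 : b + α 0 + n 0 + p = α 0 + n 0 + (b + p) := by ring
    have hne : cGammaP p (α 0 + n 0 + (b + p)) ≠ 0 :=
      cGammaP_ne_zero (by simp; linarith)
    rw [e1, show ∀ s, α 0 + n 0 + (b + p) + s = b + p + (α 0 + n 0 + s) from fun s => by ring]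
    push_cast
    field_simp

end DirichletIntegral

section PositiveRegion

variable {k : ℕ} {q : Type*} [Fintype q] [DecidableEq q] {n : Fin k → ℕ}

/-- The part of `dirichletRegion` where every weighted Gram matrix is positive definite. -/
def dirichletPosRegion (q : Type*) [Fintype q] [DecidableEq q]
    (B : (j : Fin k) → Matrix (Fin (n j)) (Fin (n j)) ℂ) :
    Set ((j : Fin k) → Fin (n j) → q → ℂ) :=
  {X | (∀ j, ((of (X j))ᴴ * B j * of (X j)).PosDef) ∧ (1 - weightedGramSum B X).PosDef}

theorem measurableSet_dirichletPosRegion (B : (j : Fin k) → Matrix (Fin (n j)) (Fin (n j)) ℂ) :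
    MeasurableSet (dirichletPosRegion q B) :=
  MeasurableSet.inter (MeasurableSet.congr
    (MeasurableSet.iInter fun j => measurableSet_setOf_posDef (continuous_weightedGram B j))
    (Set.ext fun _ => Set.mem_iInter)) (measurableSet_dirichletRegion B)

theorem setIntegral_dirichletPosRegion {B : (j : Fin k) → Matrix (Fin (n j)) (Fin (n j)) ℂ}
    (hB : ∀ j, (B j).PosDef) (α : Fin k → ℂ) (b : ℂ) :
    ∫ X in dirichletPosRegion q B,
      (∏ j, (((of (X j))ᴴ * B j * of (X j)).det.re : ℂ) ^ α j) *
        ((1 - weightedGramSum B X).det.re : ℂ) ^ b =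
    ∫ w, (∏ j, absCpow (α j) (w.1 j)) * absCpow b w.2 ∂dirichletLaw q B := by
  rw [dirichletLaw, integral_map (measurable_dirichletDets B).aemeasurable
    (measurable_prod_absCpow α b).aestronglyMeasurable]
  refine Eq.trans ?_ (setIntegral_eq_of_subset_of_forall_sdiff_eq_zero
    (measurableSet_dirichletRegion B) (s := dirichletPosRegion q B) (fun X hX => hX.2) ?_).symm
  · refine setIntegral_congr_fun (measurableSet_dirichletPosRegion B) fun X hX => ?_
    change _ = (∏ j, absCpow (α j) (((of (X j))ᴴ * B j * of (X j)).det.re)) *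
      absCpow b ((1 - weightedGramSum B X).det.re)
    rw [absCpow_of_pos b (Complex.lt_def.1 (PosDef.det_pos hX.2)).1]
    congr 1
    exact Finset.prod_congr rfl fun j _ =>
      (absCpow_of_pos (α j) (Complex.lt_def.1 (PosDef.det_pos (hX.1 j))).1).symm
  · rintro X ⟨hX, hX'⟩
    have hX1 : (1 - weightedGramSum B X).PosDef := hX
    obtain ⟨j, hj⟩ : ∃ j, ¬((of (X j))ᴴ * B j * of (X j)).PosDef := by
      by_contra! h
      exact hX' ⟨h, hX1⟩
    have hdet : ((of (X j))ᴴ * B j * of (X j)).det = 0 := by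
      by_contra h
      exact hj (((hB j).posSemidef.conjTranspose_mul_mul_same
        (of (X j))).posDef_iff_det_ne_zero.2 h)
    refine mul_eq_zero_of_left (Finset.prod_eq_zero (Finset.mem_univ j) ?_) _
    change absCpow (α j) ((of (X j))ᴴ * B j * of (X j)).det.re = 0
    rw [hdet, Complex.zero_re, absCpow_zero_right]

end PositiveRegion

theorem stmt17 (p k : ℕ) (hp : 1 ≤ p) (hk : 1 ≤ k)
    (n : Fin k → ℕ) (hn : ∀ j, p ≤ n j)
    (B : (j : Fin k) → Matrix (Fin (n j)) (Fin (n j)) ℂ) (hB : ∀ j, (B j).PosDef)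
    (α : Fin (k + 1) → ℂ)
    (hα : ∀ j : Fin k, (p - 1 : ℝ) < (α j.castSucc + n j).re)
    (hlast : (p - 1 : ℝ) < (α (Fin.last k)).re) :
    ∫ X in {X : (j : Fin k) → Matrix (Fin (n j)) (Fin p) ℂ |
        (∀ j, ((X j)ᴴ * B j * X j).PosDef) ∧ (1 - ∑ j, (X j)ᴴ * B j * X j).PosDef},
      ((∏ j : Fin k, ((((X j)ᴴ * B j * X j).det.re : ℂ) ^ (α j.castSucc))) *
        (((1 - ∑ j, (X j)ᴴ * B j * X j).det.re : ℂ) ^ (α (Fin.last k) - p)))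
      ∂(Measure.pi fun j : Fin k => (volume : Measure (Matrix (Fin (n j)) (Fin p) ℂ)))
    = (∏ j : Fin k, (((B j).det.re : ℂ) ^ (-(p : ℂ)) *
          ((Real.pi : ℂ) ^ (n j * p) / cGammaP p (n j)) *
          cGammaP p (α j.castSucc + n j))) *
        cGammaP p (α (Fin.last k)) /
          cGammaP p ((∑ j, α j) + ∑ j : Fin k, (n j : ℂ)) := by
  refine Eq.trans (setIntegral_dirichletPosRegion (q := Fin p) hB (fun j => α j.castSucc)
    (α (Fin.last k) - p)) ?_
  rw [integral_dirichletLaw p k hp n hn B hB _ _ hα (by simp; linarith)]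
  have hsum : α (Fin.last k) - p + p + ∑ j : Fin k, (α j.castSucc + n j) =
      (∑ j, α j) + ∑ j : Fin k, (n j : ℂ) := by
    rw [Fin.sum_univ_castSucc, Finset.sum_add_distrib]
    ring
  rw [hsum, sub_add_cancel]
  simp only [Complex.cpow_neg, Complex.cpow_natCast]
end

section
/- Let k ≥ 1, and for j = 1, ..., k let n_j ≥ 1 be integers and B_j be n_j×n_j complex positive definite (self-adjoint) matrices. Let α_1, ..., α_{k+1} and h be complex numbers with Re(α_j) > 0 for j = 1, ..., k+1 and Re(Σ_{j=1}^k (α_j + n_j) + h) > 0. Let f₅ be the probability density on tuples (X_1, ..., X_k) of vectors X_j ∈ ℂ^{n_j} given by f₅(X_1,...,X_k) = G̃_k ∏_{j=1}^k (X_j* B_j X_j)^{α_j} · (1 - X_1* B_1 X_1 - ... - X_k* B_k X_k)^{α_{k+1} - 1}, supported on the region where X_j* B_j X_j > 0 for all j and Σ_{j=1}^k X_j* B_j X_j < 1, where G̃_k = ( ∏_{j=1}^k det(B_j) (Γ(n_j)/π^{n_j}) (1/Γ(α_j + n_j)) ) · Γ(α_1 + ... + α_{k+1} + n_1 + ... +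 n_k) / Γ(α_{k+1}). Then the average of φ₉(X_1,...,X_k) = (X_1* B_1 X_1 + ... + X_k* B_k X_k)^h with respect to f₅ equals ( Γ(Σ_{j=1}^k (α_j + n_j) + h) / Γ(Σ_{j=1}^k (α_j + n_j)) ) · ( Γ(Σ_{j=1}^k (α_j + n_j) + α_{k+1}) / Γ(Σ_{j=1}^k (α_j + n_j) + α_{k+1} + h) ). -/
open MeasureTheory Matrix
open scoped ComplexOrder

/-- The Hermitian form `X* B X`, as a real number. -/
noncomputable def hermForm (n : ℕ) (B : Matrix (Fin n) (Fin n) ℂ) (X : Fin n → ℂ) : ℝ :=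
  (star X ⬝ᵥ B.mulVec X).re

open Set
open scoped ENNReal

/-- The density `t ^ (a - 1)` on the positive half-line, extended by zero. -/
noncomputable def powerKernel (a : ℂ) (t : ℝ) : ℂ := if 0 < t then (t : ℂ) ^ (a - 1) else 0

@[fun_prop]
lemma measurable_powerKernel (a : ℂ) : Measurable (powerKernel a) := by
  unfold powerKernel
  exact Measurable.ite measurableSet_Ioi (by fun_prop) measurable_const

lemma norm_powerKernel (a : ℂ) (t : ℝ) :
    (‖powerKernel a t‖ : ℂ) = powerKernel (a.re : ℂ) t := by
  unfold powerKernel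
  split_ifs with ht
  · rw [Complex.norm_cpow_eq_rpow_re_of_pos ht, Complex.ofReal_cpow ht.le]
    simp
  · simp

lemma powerKernel_of_nonpos (a : ℂ) {t : ℝ} (ht : t ≤ 0) : powerKernel a t = 0 :=
  if_neg ht.not_gt

lemma powerKernel_of_pos (a : ℂ) {t : ℝ} (ht : 0 < t) : powerKernel a t = (t : ℂ) ^ (a - 1) :=
  if_pos ht

lemma integral_powerKernel_mul_sub (a b : ℂ) (u : ℝ) :
    ∫ t, powerKernel a t * powerKernel b (u - t) =
      Complex.betaIntegral a b * powerKernel (a + b) u := by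
  rcases le_or_gt u 0 with hu | hu
  · rw [powerKernel_of_nonpos _ hu, mul_zero]
    refine integral_eq_zero_of_ae (.of_forall fun t => ?_)
    rcases le_or_gt t 0 with ht | ht
    · simp [powerKernel_of_nonpos _ ht]
    · simp [powerKernel_of_nonpos b (by linarith : u - t ≤ 0)]
  · rw [powerKernel_of_pos _ hu, mul_comm, ← Complex.betaIntegral_scaled a b hu,
      intervalIntegral.integral_of_le hu.le, integral_Ioc_eq_integral_Ioo,
      ← integral_indicator measurableSet_Ioo]
    congr 1
    ext t
    by_cases ht : t ∈ Ioo 0 u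
    · rw [indicator_of_mem ht, powerKernel_of_pos _ ht.1, powerKernel_of_pos _ (sub_pos.2 ht.2)]
      push_cast
      rfl
    · rw [indicator_of_notMem ht]
      rcases le_or_gt t 0 with h0 | h0
      · simp [powerKernel_of_nonpos _ h0]
      · have : u ≤ t := by by_contra h; exact ht ⟨h0, not_le.1 h⟩
        simp [powerKernel_of_nonpos b (by linarith : u - t ≤ 0)]

lemma betaIntegral_ne_zero {a b : ℂ} (ha : 0 < a.re) (hb : 0 < b.re) :
    Complex.betaIntegral a b ≠ 0 := by
  intro h
  have := Complex.Gamma_mul_Gamma_eq_betaIntegral ha hb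
  rw [h, mul_zero] at this
  exact mul_ne_zero (Complex.Gamma_ne_zero_of_re_pos ha) (Complex.Gamma_ne_zero_of_re_pos hb) this

lemma lintegral_powerKernel_mul_sub {a b : ℂ} (ha : 0 < a.re) (hb : 0 < b.re) (u : ℝ) :
    ∫⁻ t, ‖powerKernel a t‖ₑ * ‖powerKernel b (u - t)‖ₑ =
      ‖Complex.betaIntegral a.re b.re‖ₑ * ‖powerKernel (a + b) u‖ₑ := by
  simp_rw [← enorm_mul]
  rcases le_or_gt u 0 with hu | hu
  · rw [powerKernel_of_nonpos _ hu, mul_zero, enorm_zero]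
    refine (lintegral_congr fun t => ?_).trans lintegral_zero
    rcases le_or_gt t 0 with ht | ht
    · simp [powerKernel_of_nonpos _ ht]
    · simp [powerKernel_of_nonpos b (by linarith : u - t ≤ 0)]
  have hI := integral_powerKernel_mul_sub a.re b.re u
  have hne : ∫ t, powerKernel a.re t * powerKernel b.re (u - t) ≠ 0 := by
    rw [hI, powerKernel_of_pos _ hu]
    refine mul_ne_zero (betaIntegral_ne_zero (by simpa) (by simpa)) ?_
    simp [Complex.cpow_eq_zero_iff, hu.ne']
  have hint : Integrable fun t => powerKernel a.re t * powerKernel b.re (u - t) :=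
    not_imp_comm.1 integral_undef hne
  have hnorm : ∀ t, ((‖powerKernel a t * powerKernel b (u - t)‖ : ℝ) : ℂ) =
      powerKernel a.re t * powerKernel b.re (u - t) := fun t => by
    rw [norm_mul, Complex.ofReal_mul, norm_powerKernel, norm_powerKernel]
  have hint' : Integrable fun t => powerKernel a t * powerKernel b (u - t) := by
    refine hint.mono (by fun_prop) (.of_forall fun t => ?_)
    rw [← hnorm]; simp
  have hr : ((∫ t, ‖powerKernel a t * powerKernel b (u - t)‖ : ℝ) : ℂ) =
      Complex.betaIntegral a.re b.re * powerKernel (a.re + b.re) u := by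
    rw [← integral_complex_ofReal, ← hI]
    exact integral_congr_ae (.of_forall hnorm)
  have hk : ‖powerKernel (a + b) u‖ = ‖powerKernel (a.re + b.re) u‖ := by
    simp [powerKernel_of_pos _ hu, Complex.norm_cpow_eq_rpow_re_of_pos hu]
  rw [← ofReal_integral_norm_eq_lintegral_enorm hint', ← ofReal_norm, norm_mul, hk, ← norm_mul,
    ← hr, Complex.norm_real, Real.norm_of_nonneg (integral_nonneg fun _ => norm_nonneg _)]

lemma integrable_powerKernel_mul_sub {a b : ℂ} (ha : 0 < a.re) (hb : 0 < b.re) (u : ℝ) :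
    Integrable fun t => powerKernel a t * powerKernel b (u - t) := by
  refine ⟨by fun_prop, ?_⟩
  rw [hasFiniteIntegral_iff_enorm]
  simp_rw [enorm_mul]
  rw [lintegral_powerKernel_mul_sub ha hb]
  exact ENNReal.mul_lt_top enorm_lt_top enorm_lt_top

lemma lintegral_powerKernel_shift {a b : ℂ} (ha : 0 < a.re) (hb : 0 < b.re) {g : ℝ → ℝ≥0∞}
    (hg : Measurable g) :
    ∫⁻ t, ‖powerKernel a t‖ₑ * ∫⁻ s, ‖powerKernel b s‖ₑ * g (t + s) =
      ‖Complex.betaIntegral a.re b.re‖ₑ * ∫⁻ u, ‖powerKernel (a + b) u‖ₑ * g u := by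
  calc
    _ = ∫⁻ t, ∫⁻ u, ‖powerKernel a t‖ₑ * ‖powerKernel b (u - t)‖ₑ * g u := by
      refine lintegral_congr fun t => ?_
      rw [← lintegral_sub_right_eq_self _ t, ← lintegral_const_mul _ (by fun_prop)]
      simp [mul_assoc]
    _ = ∫⁻ u, ∫⁻ t, ‖powerKernel a t‖ₑ * ‖powerKernel b (u - t)‖ₑ * g u :=
      lintegral_lintegral_swap (by fun_prop)
    _ = ∫⁻ u, ‖Complex.betaIntegral a.re b.re‖ₑ * (‖powerKernel (a + b) u‖ₑ * g u) := by
      refine lintegral_congr fun u => ?_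
      rw [lintegral_mul_const _ (by fun_prop), lintegral_powerKernel_mul_sub ha hb, mul_assoc]
    _ = _ := lintegral_const_mul _ (by fun_prop)

lemma integral_powerKernel_shift {a b : ℂ} (ha : 0 < a.re) (hb : 0 < b.re) {g : ℝ → ℂ}
    (hg : Measurable g) (hint : Integrable fun u => powerKernel (a + b) u * g u) :
    ∫ t, powerKernel a t * ∫ s, powerKernel b s * g (t + s) =
      Complex.betaIntegral a b * ∫ u, powerKernel (a + b) u * g u := by
  calc
    _ = ∫ t, ∫ u, powerKernel a t * powerKernel b (u - t) * g u := by
      refine integral_congr_ae (.of_forall fun t => ?_)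
      dsimp only
      rw [← integral_sub_right_eq_self _ t, ← integral_const_mul]
      simp [mul_assoc]
    _ = ∫ u, ∫ t, powerKernel a t * powerKernel b (u - t) * g u := by
      refine integral_integral_swap ⟨by fun_prop, ?_⟩
      rw [hasFiniteIntegral_iff_enorm, lintegral_prod_symm _ (by fun_prop)]
      simp only [Function.uncurry, enorm_mul]
      have : ∀ u, ∫⁻ t, ‖powerKernel a t‖ₑ * ‖powerKernel b (u - t)‖ₑ * ‖g u‖ₑ =
          ‖Complex.betaIntegral a.re b.re‖ₑ * ‖powerKernel (a + b) u * g u‖ₑ := fun u => by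
        rw [lintegral_mul_const _ (by fun_prop), lintegral_powerKernel_mul_sub ha hb, mul_assoc,
          enorm_mul]
      simp_rw [this]
      rw [lintegral_const_mul _ (by fun_prop)]
      exact ENNReal.mul_lt_top enorm_lt_top hint.2
    _ = ∫ u, Complex.betaIntegral a b * (powerKernel (a + b) u * g u) := by
      refine integral_congr_ae (.of_forall fun u => ?_)
      dsimp only
      rw [integral_mul_const, integral_powerKernel_mul_sub, mul_assoc]
    _ = _ := integral_const_mul _ _

/-- The weight `w` pushes `μ` forward along `r` to `C / Γ(a)` times `t ^ (a - 1) dt` on the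
positive half-line; the weight need not be integrable. -/
structure HasPowerLaw {Ω : Type*} [MeasurableSpace Ω] (μ : Measure Ω) (w : Ω → ℂ) (r : Ω → ℝ)
    (a C : ℂ) : Prop where
  re_pos : 0 < a.re
  measurable_weight : Measurable w
  measurable_radius : Measurable r
  lintegral_le : ∃ K : ℝ≥0∞, K ≠ ∞ ∧ ∀ g : ℝ → ℝ≥0∞, Measurable g →
    ∫⁻ x, ‖w x‖ₑ * g (r x) ∂μ ≤ K * ∫⁻ t, ‖powerKernel a t‖ₑ * g t
  integral_eq : ∀ g : ℝ → ℂ, Measurable g → Integrable (fun t => powerKernel a t * g t) →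
    ∫ x, w x * g (r x) ∂μ = C / Complex.Gamma a * ∫ t, powerKernel a t * g t

namespace HasPowerLaw

variable {Ω Ω' : Type*} [MeasurableSpace Ω] [MeasurableSpace Ω'] {μ : Measure Ω} {ν : Measure Ω'}
  {w : Ω → ℂ} {r : Ω → ℝ} {a C : ℂ} {w' : Ω' → ℂ} {r' : Ω' → ℝ} {b D : ℂ}

lemma comp_measurePreserving (hd : HasPowerLaw ν w' r' b D) {e : Ω ≃ᵐ Ω'}
    (he : MeasurePreserving e μ ν) : HasPowerLaw μ (w' ∘ e) (r' ∘ e) b D where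
  re_pos := hd.re_pos
  measurable_weight := hd.measurable_weight.comp e.measurable
  measurable_radius := hd.measurable_radius.comp e.measurable
  lintegral_le := by
    obtain ⟨K, hK, h⟩ := hd.lintegral_le
    refine ⟨K, hK, fun g hg => (h g hg).trans' (le_of_eq ?_)⟩
    exact he.lintegral_comp_emb e.measurableEmbedding fun y => ‖w' y‖ₑ * g (r' y)
  integral_eq g hg hint := by
    rw [← hd.integral_eq g hg hint]
    exact he.integral_comp' fun y => w' y * g (r' y)

lemma lintegral_prod_le [SFinite ν] (h₁ : HasPowerLaw μ w r a C) (h₂ : HasPowerLaw ν w' r' b D) :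
    ∃ K : ℝ≥0∞, K ≠ ∞ ∧ ∀ g : ℝ → ℝ≥0∞, Measurable g →
      ∫⁻ z, ‖w z.1 * w' z.2‖ₑ * g (r z.1 + r' z.2) ∂(μ.prod ν) ≤
        K * ∫⁻ t, ‖powerKernel (a + b) t‖ₑ * g t := by
  obtain ⟨K, hK, hle⟩ := h₁.lintegral_le
  obtain ⟨L, hL, hle'⟩ := h₂.lintegral_le
  have := h₁.measurable_weight
  have := h₂.measurable_weight
  have := h₁.measurable_radius
  have := h₂.measurable_radius
  refine ⟨L * K * ‖Complex.betaIntegral a.re b.re‖ₑ,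
    ENNReal.mul_ne_top (ENNReal.mul_ne_top hL hK) enorm_ne_top, fun g hg => ?_⟩
  have hG : Measurable fun t => ∫⁻ s, ‖powerKernel b s‖ₑ * g (t + s) :=
    Measurable.lintegral_prod_right' (f := fun p : ℝ × ℝ => ‖powerKernel b p.2‖ₑ * g (p.1 + p.2))
      (by fun_prop)
  rw [lintegral_prod _ (by fun_prop)]
  calc
    _ = ∫⁻ x, ‖w x‖ₑ * (∫⁻ y, ‖w' y‖ₑ * g (r x + r' y) ∂ν) ∂μ := by
      refine lintegral_congr fun x => ?_
      rw [← lintegral_const_mul _ (by fun_prop)]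
      simp [enorm_mul, mul_assoc]
    _ ≤ ∫⁻ x, ‖w x‖ₑ * (L * ∫⁻ s, ‖powerKernel b s‖ₑ * g (r x + s)) ∂μ := by
      gcongr with x
      exact hle' (fun s => g (r x + s)) (by fun_prop)
    _ = L * ∫⁻ x, ‖w x‖ₑ * (∫⁻ s, ‖powerKernel b s‖ₑ * g (r x + s)) ∂μ := by
      exact (lintegral_congr fun x => mul_left_comm _ _ _).trans
        (lintegral_const_mul _ (h₁.measurable_weight.enorm.mul (hG.comp h₁.measurable_radius)))
    _ ≤ L * (K * ∫⁻ t, ‖powerKernel a t‖ₑ * ∫⁻ s, ‖powerKernel b s‖ₑ * g (t + s)) := by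
      gcongr
      exact hle _ hG
    _ = _ := by
      rw [lintegral_powerKernel_shift h₁.re_pos h₂.re_pos hg]
      ring

lemma prod [SFinite μ] [SFinite ν] (h₁ : HasPowerLaw μ w r a C) (h₂ : HasPowerLaw ν w' r' b D) :
    HasPowerLaw (μ.prod ν) (fun z => w z.1 * w' z.2) (fun z => r z.1 + r' z.2) (a + b)
      (C * D) := by
  have := h₁.measurable_weight
  have := h₂.measurable_weight
  have := h₁.measurable_radius
  have := h₂.measurable_radius
  have ha := h₁.re_pos
  have hb := h₂.re_pos
  refine ⟨by simpa using add_pos ha hb, by fun_prop, by fun_prop,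
    lintegral_prod_le h₁ h₂, fun g hg hint => ?_⟩
  obtain ⟨M, hM, hle⟩ := lintegral_prod_le h₁ h₂
  obtain ⟨K, hK, hle₁⟩ := h₁.lintegral_le
  have hfin : ∫⁻ t, ‖powerKernel (a + b) t‖ₑ * ‖g t‖ₑ < ∞ := by
    simpa [hasFiniteIntegral_iff_enorm, enorm_mul] using hint.2
  have hprod : Integrable (fun z : Ω × Ω' => w z.1 * w' z.2 * g (r z.1 + r' z.2)) (μ.prod ν) := by
    refine ⟨by fun_prop, ?_⟩
    rw [hasFiniteIntegral_iff_enorm]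
    simp_rw [enorm_mul (_ * _) _]
    exact (hle (fun t => ‖g t‖ₑ) (by fun_prop)).trans_lt (ENNReal.mul_lt_top hM.lt_top hfin)
  set H : ℝ → ℝ≥0∞ := fun t => ∫⁻ s, ‖powerKernel b s‖ₑ * ‖g (t + s)‖ₑ with hHdef
  set G : ℝ → ℂ := fun t => ∫ s, powerKernel b s * g (t + s) with hGdef
  have hHm : Measurable H :=
    Measurable.lintegral_prod_right'
      (f := fun p : ℝ × ℝ => ‖powerKernel b p.2‖ₑ * ‖g (p.1 + p.2)‖ₑ) (by fun_prop)
  have hGm : Measurable G :=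
    (StronglyMeasurable.integral_prod_right'
      (f := fun p : ℝ × ℝ => powerKernel b p.2 * g (p.1 + p.2))
      (Measurable.stronglyMeasurable (by fun_prop))).measurable
  have hGH : ∀ t, ‖G t‖ₑ ≤ H t := fun t => by
    simpa only [enorm_mul] using
      enorm_integral_le_lintegral_enorm fun s => powerKernel b s * g (t + s)
  have hHfin : ∫⁻ t, ‖powerKernel a t‖ₑ * H t < ∞ := by
    rw [hHdef, lintegral_powerKernel_shift ha hb (g := fun t => ‖g t‖ₑ) (by fun_prop)]
    exact ENNReal.mul_lt_top enorm_lt_top hfin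
  have hGint : Integrable fun t => powerKernel a t * G t := by
    refine ⟨by fun_prop, ?_⟩
    rw [hasFiniteIntegral_iff_enorm]
    refine (lintegral_mono fun t => ?_).trans_lt hHfin
    rw [enorm_mul]
    gcongr
    exact hGH t
  have hae : ∀ᵐ x ∂μ, ‖w x‖ₑ * H (r x) < ∞ :=
    ae_lt_top (by fun_prop) ((hle₁ H hHm).trans_lt (ENNReal.mul_lt_top hK.lt_top hHfin)).ne
  have hslice : ∀ᵐ x ∂μ, ∫ y, w x * w' y * g (r x + r' y) ∂ν =
      D / Complex.Gamma b * (w x * G (r x)) := by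
    filter_upwards [hae] with x hx
    simp_rw [mul_assoc (w x)]
    rw [integral_const_mul]
    rcases eq_or_ne (w x) 0 with h0 | h0
    · simp [h0]
    have hHx : H (r x) < ∞ := by
      by_contra hcon
      rw [not_lt_top_iff.1 hcon, ENNReal.mul_top (by simpa using h0)] at hx
      exact lt_irrefl _ hx
    rw [h₂.integral_eq (fun s => g (r x + s)) (by fun_prop) ⟨by fun_prop, ?_⟩]
    · rw [hGdef]; ring
    · simpa [hasFiniteIntegral_iff_enorm, enorm_mul] using hHx
  rw [integral_prod _ hprod, integral_congr_ae hslice, integral_const_mul,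
    h₁.integral_eq G hGm hGint, integral_powerKernel_shift ha hb hg hint]
  have hab : Complex.Gamma (a + b) ≠ 0 :=
    Complex.Gamma_ne_zero_of_re_pos (by simpa using add_pos ha hb)
  have hΓa := Complex.Gamma_ne_zero_of_re_pos ha
  have hΓb := Complex.Gamma_ne_zero_of_re_pos hb
  have hβ : Complex.betaIntegral a b =
      Complex.Gamma a * Complex.Gamma b / Complex.Gamma (a + b) := by
    rw [Complex.Gamma_mul_Gamma_eq_betaIntegral ha hb]
    field_simp
  rw [hβ]
  field_simp

end HasPowerLaw

lemma hasPowerLaw_pi {m : ℕ} {Ω : Fin (m + 1) → Type} [∀ j, MeasurableSpace (Ω j)]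
    {μ : ∀ j, Measure (Ω j)} [∀ j, SigmaFinite (μ j)] {w : ∀ j, Ω j → ℂ} {r : ∀ j, Ω j → ℝ}
    {a C : Fin (m + 1) → ℂ} (hd : ∀ j, HasPowerLaw (μ j) (w j) (r j) (a j) (C j)) :
    HasPowerLaw (Measure.pi μ) (fun x => ∏ j, w j (x j)) (fun x => ∑ j, r j (x j))
      (∑ j, a j) (∏ j, C j) := by
  induction m with
  | zero =>
    let _ : Unique (Fin (0 + 1)) := (inferInstance : Unique (Fin 1))
    convert! HasPowerLaw.comp_measurePreserving (hd _) (e := MeasurableEquiv.piUnique Ω)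
      (measurePreserving_piUnique μ) using 1
    · ext x; simp
    · ext x; simp
    · simp
    · simp
  | succ m ih =>
    have htail := ih fun j => hd j.succ
    convert! ((hd 0).prod htail).comp_measurePreserving (measurePreserving_piFinSuccAbove μ 0)
      using 1
    · ext x; rw [Fin.prod_univ_succ]; rfl
    · ext x; rw [Fin.sum_univ_succ]; rfl
    · simp [Fin.sum_univ_succ]
    · simp [Fin.prod_univ_succ]

lemma measurable_hermForm (n : ℕ) (B : Matrix (Fin n) (Fin n) ℂ) : Measurable (hermForm n B) := by
  unfold hermForm
  simp only [dotProduct, mulVec]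
  fun_prop

lemma hermForm_conjTranspose_mul_self {n : ℕ} (A : Matrix (Fin n) (Fin n) ℂ) (X : Fin n → ℂ) :
    hermForm n (Aᴴ * A) X = ∑ i, ‖A.mulVec X i‖ ^ 2 := by
  unfold hermForm
  rw [← mulVec_mulVec, dotProduct_mulVec, ← star_mulVec, dotProduct, Complex.re_sum]
  refine Finset.sum_congr rfl fun i _ => ?_
  rw [Pi.star_apply, Complex.star_def, Complex.conj_mul', ← Complex.ofReal_pow, Complex.ofReal_re]

open scoped MatrixOrder in
lemma exists_conjTranspose_mul_self {n : ℕ} {B : Matrix (Fin n) (Fin n) ℂ} (hB : B.PosDef) :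
    ∃ A : Matrix (Fin n) (Fin n) ℂ, B = Aᴴ * A :=
  CStarAlgebra.nonneg_iff_eq_star_mul_self.1 hB.posSemidef.nonneg

lemma volume_sum_norm_sq_lt {n : ℕ} (hn : 1 ≤ n) (t : ℝ) :
    volume {X : Fin n → ℂ | ∑ i, ‖X i‖ ^ 2 < t} =
      ENNReal.ofReal t ^ n * ENNReal.ofReal (Real.pi ^ n / Real.Gamma (n + 1)) := by
  have : Nonempty (Fin n) := ⟨⟨0, hn⟩⟩
  rcases le_or_gt t 0 with ht | ht
  · have : {X : Fin n → ℂ | ∑ i, ‖X i‖ ^ 2 < t} = ∅ := by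
      ext X
      simpa using ht.trans (Finset.sum_nonneg fun i _ => by positivity)
    rw [this, ENNReal.ofReal_of_nonpos ht]
    simp [show n ≠ 0 by omega]
  · have h := Complex.volume_sum_rpow_lt (Fin n) (p := 2) (by norm_num) (Real.sqrt t)
    have hset : {X : Fin n → ℂ | (∑ i, ‖X i‖ ^ (2 : ℝ)) ^ (1 / (2 : ℝ)) < Real.sqrt t} =
        {X : Fin n → ℂ | ∑ i, ‖X i‖ ^ 2 < t} := by
      ext X
      simp only [Real.rpow_two, ← Real.sqrt_eq_rpow, mem_ofPred_eq]
      exact Real.sqrt_lt_sqrt_iff (Finset.sum_nonneg fun i _ => by positivity)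
    rw [hset] at h
    rw [h, pow_mul, ← ENNReal.ofReal_pow (Real.sqrt_nonneg _), Real.sq_sqrt ht.le]
    norm_num [Real.Gamma_two]

lemma volume_hermForm_lt {n : ℕ} (hn : 1 ≤ n) {B : Matrix (Fin n) (Fin n) ℂ} (hB : B.PosDef)
    (t : ℝ) :
    volume {X : Fin n → ℂ | hermForm n B X < t} = ENNReal.ofReal t ^ n *
      ENNReal.ofReal (Real.pi ^ n / (B.det.re * Real.Gamma (n + 1))) := by
  obtain ⟨A, rfl⟩ := exists_conjTranspose_mul_self hB
  have hdet : (Aᴴ * A).det.re = ‖A.det‖ ^ 2 := by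
    rw [det_mul, det_conjTranspose, Complex.star_def, Complex.conj_mul', ← Complex.ofReal_pow,
      Complex.ofReal_re]
  have hpos : 0 < ‖A.det‖ ^ 2 := by
    rw [← hdet]
    exact (Complex.pos_iff.1 hB.det_pos).1
  set f : (Fin n → ℂ) →ₗ[ℝ] (Fin n → ℂ) := (Matrix.toLin' A).restrictScalars ℝ with hf
  have hfdet : LinearMap.det f = ‖A.det‖ ^ 2 := by
    rw [hf, LinearMap.det_restrictScalars, LinearMap.det_toLin', Algebra.norm_complex_eq]
    exact Complex.normSq_eq_norm_sq _
  have hset : {X : Fin n → ℂ | hermForm n (Aᴴ * A) X < t} =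
      f ⁻¹' {X | ∑ i, ‖X i‖ ^ 2 < t} := by
    ext X
    simp [hermForm_conjTranspose_mul_self, hf]
  rw [hset, Measure.addHaar_preimage_linearMap volume (by rw [hfdet]; exact hpos.ne'),
    volume_sum_norm_sq_lt hn, hfdet, hdet, mul_left_comm, ← ENNReal.ofReal_mul (abs_nonneg _),
    abs_of_pos (inv_pos.2 hpos)]
  congr 2
  field_simp

lemma hermForm_nonneg {n : ℕ} {B : Matrix (Fin n) (Fin n) ℂ} (hB : B.PosDef) (X : Fin n → ℂ) :
    0 ≤ hermForm n B X :=
  (Complex.nonneg_iff.1 (hB.posSemidef.dotProduct_mulVec_nonneg X)).1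

lemma setLIntegral_powerKernel_natCast {n : ℕ} (hn : 1 ≤ n) (t : ℝ) :
    ∫⁻ s in Iio t, ‖powerKernel n s‖ₑ = ENNReal.ofReal t ^ n / n := by
  have hn0 : n ≠ 0 := by omega
  have hind : ∫⁻ s in Iio t, ‖powerKernel n s‖ₑ =
      ∫⁻ s in Ioo 0 t, ENNReal.ofReal (s ^ (n - 1)) := by
    rw [← lintegral_indicator measurableSet_Iio, ← lintegral_indicator measurableSet_Ioo]
    congr 1
    ext s
    rcases le_or_gt s 0 with hs | hs
    · rw [indicator_of_notMem (s := Ioo 0 t) (fun h => hs.not_gt h.1)]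
      simp [indicator, powerKernel_of_nonpos _ hs]
    · have : (n : ℂ) - 1 = ((n - 1 : ℕ) : ℂ) := by push_cast [hn]; rfl
      have hk : ‖powerKernel n s‖ₑ = ENNReal.ofReal (s ^ (n - 1)) := by
        rw [powerKernel_of_pos _ hs, this, Complex.cpow_natCast, ← ofReal_norm, norm_pow,
          Complex.norm_real, Real.norm_of_nonneg hs.le]
      simp [indicator, hs, hk]
  rw [hind]
  rcases le_or_gt t 0 with ht | ht
  · simp [Ioo_eq_empty ht.not_gt, ENNReal.ofReal_of_nonpos ht, hn0]
  rw [← ofReal_integral_eq_lintegral_ofReal, ← integral_Ioc_eq_integral_Ioo,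
    ← intervalIntegral.integral_of_le ht.le, integral_pow]
  · have : ((n - 1 : ℕ) : ℝ) + 1 = n := by push_cast [hn]; ring
    rw [Nat.sub_add_cancel hn, this, zero_pow hn0, sub_zero,
      ENNReal.ofReal_div_of_pos (by positivity), ENNReal.ofReal_pow ht.le, ENNReal.ofReal_natCast]
  · exact ((continuous_pow _).integrableOn_Icc (a := 0) (b := t)).mono_set Ioo_subset_Icc_self
  · filter_upwards [ae_restrict_mem measurableSet_Ioo] with s hs
    exact pow_nonneg hs.1.le _

lemma map_hermForm_volume {n : ℕ} (hn : 1 ≤ n) {B : Matrix (Fin n) (Fin n) ℂ} (hB : B.PosDef) :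
    Measure.map (hermForm n B) volume =
      ENNReal.ofReal (Real.pi ^ n / (B.det.re * Real.Gamma n)) •
        volume.withDensity (fun t => ‖powerKernel n t‖ₑ) := by
  have hn0 : (n : ℝ) ≠ 0 := by positivity
  have hdet : 0 < B.det.re := (Complex.pos_iff.1 hB.det_pos).1
  have hΓ : 0 < Real.Gamma n := Real.Gamma_pos_of_pos (by positivity)
  set μ := Measure.map (hermForm n B) volume with hμ
  set ν := ENNReal.ofReal (Real.pi ^ n / (B.det.re * Real.Gamma n)) •
    volume.withDensity (fun t => ‖powerKernel n t‖ₑ) with hν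
  have hμt : ∀ t, μ (Iio t) = ENNReal.ofReal t ^ n *
      ENNReal.ofReal (Real.pi ^ n / (B.det.re * Real.Gamma (n + 1))) := fun t => by
    rw [hμ, Measure.map_apply (measurable_hermForm n B) measurableSet_Iio,
      ← volume_hermForm_lt hn hB]
    rfl
  have hνt : ∀ t, ν (Iio t) = μ (Iio t) := fun t => by
    rw [hν, Measure.smul_apply, withDensity_apply _ measurableSet_Iio,
      setLIntegral_powerKernel_natCast hn, hμt, Real.Gamma_add_one hn0, smul_eq_mul, mul_comm,
      div_eq_mul_inv, mul_assoc, ← ENNReal.ofReal_natCast n,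
      ← ENNReal.ofReal_inv_of_pos (by positivity), ← ENNReal.ofReal_mul (by positivity)]
    congr 2
    field_simp
  have hfin : ∀ t, μ (Iio t) ≠ ∞ := fun t => by
    rw [hμt]
    exact ENNReal.mul_ne_top (ENNReal.pow_ne_top ENNReal.ofReal_ne_top) ENNReal.ofReal_ne_top
  refine Measure.ext_of_Ico' μ ν
    (fun a b _ => ((measure_mono Ico_subset_Iio_self).trans_lt (hfin b).lt_top).ne) fun a b hab => ?_
  have hdiff (κ : Measure ℝ) (hκ : κ (Iio a) ≠ ∞) : κ (Ico a b) = κ (Iio b) - κ (Iio a) := by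
    rw [← Ici_inter_Iio, inter_comm, ← compl_Iio, ← sdiff_eq,
      measure_sdiff (Iio_subset_Iio hab.le) measurableSet_Iio.nullMeasurableSet hκ]
  rw [hdiff μ (hfin a), hdiff ν (by rw [hνt]; exact hfin a), hνt, hνt]

lemma powerKernel_mul_norm_powerKernel (n : ℕ) (a : ℂ) (t : ℝ) :
    powerKernel (a + 1) t * ‖powerKernel n t‖ = powerKernel (a + n) t := by
  rcases le_or_gt t 0 with ht | ht
  · simp [powerKernel_of_nonpos _ ht]
  rw [norm_powerKernel, powerKernel_of_pos _ ht, powerKernel_of_pos _ ht, powerKernel_of_pos _ ht,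
    ← Complex.cpow_add _ _ (by exact_mod_cast ht.ne')]
  congr 1
  simp
  ring

lemma hasPowerLaw_hermForm {n : ℕ} (hn : 1 ≤ n) {B : Matrix (Fin n) (Fin n) ℂ} (hB : B.PosDef)
    {a : ℂ} (ha : 0 < a.re) :
    HasPowerLaw (volume : Measure (Fin n → ℂ)) (fun X => powerKernel (a + 1) (hermForm n B X))
      (hermForm n B) (a + n)
      (Real.pi ^ n / (B.det.re * Complex.Gamma n) * Complex.Gamma (a + n)) := by
  have hm := measurable_hermForm n B
  have hre : 0 < (a + n).re := by simp; positivity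
  have hmap := map_hermForm_volume hn hB
  have hdet : 0 < B.det.re := (Complex.pos_iff.1 hB.det_pos).1
  have hΓ : 0 < Real.Gamma n := Real.Gamma_pos_of_pos (by positivity)
  have hΓn := Complex.Gamma_ne_zero_of_re_pos hre
  set c : ℝ := Real.pi ^ n / (B.det.re * Real.Gamma n) with hc
  refine ⟨hre, by fun_prop, hm, ⟨ENNReal.ofReal c, ENNReal.ofReal_ne_top, fun g hg => le_of_eq ?_⟩,
    fun g hg _ => ?_⟩
  · rw [← lintegral_map (f := fun t => ‖powerKernel (a + 1) t‖ₑ * g t) (by fun_prop) hm, hmap,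
      lintegral_smul_measure, lintegral_withDensity_eq_lintegral_mul _ (by fun_prop) (by fun_prop)]
    rw [smul_eq_mul]
    congr 1
    refine lintegral_congr fun t => ?_
    rw [← powerKernel_mul_norm_powerKernel]
    have : ‖(‖powerKernel n t‖ : ℂ)‖ₑ = ‖powerKernel n t‖ₑ := by
      rw [← ofReal_norm, Complex.norm_real, norm_norm, ofReal_norm]
    rw [enorm_mul, this, Pi.mul_apply]
    ring
  · rw [← integral_map (f := fun t => powerKernel (a + 1) t * g t) hm.aemeasurable (by fun_prop),
      hmap, integral_smul_measure, integral_withDensity_eq_integral_toReal_smul (by fun_prop)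
      (.of_forall fun _ => enorm_lt_top), ENNReal.toReal_ofReal (by positivity), hc,
      mul_div_assoc, div_self hΓn, mul_one, Complex.real_smul]
    congr 1
    · push_cast [Complex.Gamma_ofReal]
      rw [← Complex.Gamma_ofReal]
      simp
    · refine integral_congr_ae (.of_forall fun t => ?_)
      dsimp only
      rw [← powerKernel_mul_norm_powerKernel, toReal_enorm, Complex.real_smul]
      ring

theorem stmt18 (k : ℕ) (hk : 1 ≤ k) (n : Fin k → ℕ) (hn : ∀ j, 1 ≤ n j)
    (B : (j : Fin k) → Matrix (Fin (n j)) (Fin (n j)) ℂ) (hB : ∀ j, (B j).PosDef)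
    (α : Fin (k + 1) → ℂ) (h : ℂ)
    (hα : ∀ j, 0 < (α j).re)
    (hh : 0 < ((∑ j : Fin k, (α j.castSucc + n j)) + h).re) :
    ∫ X in {X : (j : Fin k) → (Fin (n j) → ℂ) |
        (∀ j, 0 < hermForm (n j) (B j) (X j)) ∧ ∑ j, hermForm (n j) (B j) (X j) < 1},
      (((∑ j, hermForm (n j) (B j) (X j) : ℝ) : ℂ) ^ h *
        (((∏ j : Fin k, (((B j).det.re : ℂ) *
              (Complex.Gamma (n j) / (Real.pi : ℂ) ^ (n j : ℕ)) *
              (Complex.Gamma (α j.castSucc + n j))⁻¹)) *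
            Complex.Gamma ((∑ j, α j) + ∑ j : Fin k, (n j : ℂ)) /
            Complex.Gamma (α (Fin.last k))) *
          (∏ j : Fin k, ((hermForm (n j) (B j) (X j) : ℂ) ^ (α j.castSucc))) *
          (((1 - ∑ j, hermForm (n j) (B j) (X j) : ℝ) : ℂ) ^ (α (Fin.last k) - 1))))
      ∂(Measure.pi fun j : Fin k => (volume : Measure (Fin (n j) → ℂ)))
    = Complex.Gamma ((∑ j : Fin k, (α j.castSucc + n j)) + h) /
        Complex.Gamma (∑ j : Fin k, (α j.castSucc + n j)) *
        (Complex.Gamma ((∑ j : Fin k, (α j.castSucc + n j)) + α (Fin.last k)) /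
          Complex.Gamma ((∑ j : Fin k, (α j.castSucc + n j)) + α (Fin.last k) + h)) := by
  obtain ⟨m, rfl⟩ : ∃ m, k = m + 1 := ⟨k - 1, by omega⟩
  have hpow := hasPowerLaw_pi fun j =>
    hasPowerLaw_hermForm (hn j) (hB j) (hα j.castSucc)
  have hsum : (∑ j, α j) + ∑ j : Fin (m + 1), (n j : ℂ) =
      (∑ j : Fin (m + 1), (α j.castSucc + n j)) + α (Fin.last (m + 1)) := by
    rw [Fin.sum_univ_castSucc, Finset.sum_add_distrib]
    ring
  rw [hsum]
  have hA := hpow.re_pos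
  have hγ := hα (Fin.last (m + 1))
  set A := ∑ j : Fin (m + 1), (α j.castSucc + n j)
  set γ := α (Fin.last (m + 1))
  set N := ∏ j : Fin (m + 1), (((B j).det.re : ℂ) *
    (Complex.Gamma (n j) / (Real.pi : ℂ) ^ (n j : ℕ)) *
    (Complex.Gamma (α j.castSucc + n j))⁻¹) with hN
  have hmeas : MeasurableSet {X : (j : Fin (m + 1)) → (Fin (n j) → ℂ) |
      (∀ j, 0 < hermForm (n j) (B j) (X j)) ∧ ∑ j, hermForm (n j) (B j) (X j) < 1} := by
    have hq (j : Fin (m + 1)) : Measurable fun X : (j : Fin (m + 1)) → (Fin (n j) → ℂ) =>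
        hermForm (n j) (B j) (X j) := (measurable_hermForm _ _).comp (measurable_pi_apply j)
    have hinter := (MeasurableSet.iInter fun j =>
      measurableSet_lt (measurable_const (a := (0 : ℝ))) (hq j)).inter
      (measurableSet_lt hpow.measurable_radius (measurable_const (a := (1 : ℝ))))
    convert hinter using 1
    ext X
    simp
  have hshift : ∀ t : ℝ, powerKernel A t * (powerKernel (h + 1) t * powerKernel γ (1 - t)) =
      powerKernel (A + h) t * powerKernel γ (1 - t) := fun t => by
    rcases le_or_gt t 0 with ht | ht
    · simp [powerKernel_of_nonpos _ ht]
    rw [← mul_assoc, powerKernel_of_pos _ ht, powerKernel_of_pos _ ht, powerKernel_of_pos _ ht,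
      ← Complex.cpow_add _ _ (by exact_mod_cast ht.ne')]
    congr 3
    ring
  have hint := hpow.integral_eq (fun t => powerKernel (h + 1) t * powerKernel γ (1 - t))
    (by fun_prop) (by
      simp_rw [hshift]
      exact integrable_powerKernel_mul_sub hh hγ 1)
  simp_rw [hshift] at hint
  rw [integral_powerKernel_mul_sub, powerKernel_of_pos _ one_pos, Complex.ofReal_one,
    Complex.one_cpow, mul_one] at hint
  have hΓA := Complex.Gamma_ne_zero_of_re_pos hA
  have hΓγ := Complex.Gamma_ne_zero_of_re_pos hγ
  have hΓAh : Complex.Gamma (A + h + γ) ≠ 0 :=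
    Complex.Gamma_ne_zero_of_re_pos (by simpa using add_pos hh hγ)
  have hβ : Complex.betaIntegral (A + h) γ =
      Complex.Gamma (A + h) * Complex.Gamma γ / Complex.Gamma (A + h + γ) := by
    rw [Complex.Gamma_mul_Gamma_eq_betaIntegral hh hγ]
    field_simp
  have hNC : N * ∏ j : Fin (m + 1), (Real.pi ^ n j / ((B j).det.re * Complex.Gamma (n j)) *
      Complex.Gamma (α j.castSucc + n j)) = 1 := by
    rw [hN, ← Finset.prod_mul_distrib]
    refine Finset.prod_eq_one fun j _ => ?_
    have hd : ((B j).det.re : ℂ) ≠ 0 := by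
      exact_mod_cast (Complex.pos_iff.1 (hB j).det_pos).1.ne'
    have h1 : Complex.Gamma (n j) ≠ 0 :=
      Complex.Gamma_ne_zero_of_re_pos (by simpa using Nat.succ_le_iff.1 (hn j))
    have h2 : Complex.Gamma (α j.castSucc + n j) ≠ 0 :=
      Complex.Gamma_ne_zero_of_re_pos (by simpa using add_pos_of_pos_of_nonneg (hα _) (by simp))
    have h3 : (Real.pi : ℂ) ≠ 0 := by exact_mod_cast Real.pi_ne_zero
    field_simp
  rw [← integral_indicator hmeas]
  calc
    _ = N * Complex.Gamma (A + γ) / Complex.Gamma γ *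
        ∫ X, (∏ j, powerKernel (α j.castSucc + 1) (hermForm (n j) (B j) (X j))) *
          (powerKernel (h + 1) (∑ j, hermForm (n j) (B j) (X j)) *
            powerKernel γ (1 - ∑ j, hermForm (n j) (B j) (X j)))
          ∂(Measure.pi fun j => (volume : Measure (Fin (n j) → ℂ))) := by
      rw [← integral_const_mul]
      congr 1
      ext X
      by_cases hX : (∀ j, 0 < hermForm (n j) (B j) (X j)) ∧ ∑ j, hermForm (n j) (B j) (X j) < 1
      · rw [indicator_of_mem (by exact hX), powerKernel_of_pos _ (sub_pos.2 hX.2),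
          powerKernel_of_pos _ (Finset.sum_pos (fun j _ => hX.1 j) Finset.univ_nonempty),
          Finset.prod_congr rfl fun j _ => powerKernel_of_pos _ (hX.1 j)]
        simp only [add_sub_cancel_right]
        ring
      · rw [indicator_of_notMem (by exact hX)]
        rcases not_and_or.1 hX with hX | hX
        · obtain ⟨j, hj⟩ := not_forall.1 hX
          rw [Finset.prod_eq_zero (Finset.mem_univ j) (powerKernel_of_nonpos _ (not_lt.1 hj))]
          ring
        · rw [powerKernel_of_nonpos γ (by linarith [not_lt.1 hX])]
          ring
    _ = (N * ∏ j : Fin (m + 1), (Real.pi ^ n j / ((B j).det.re * Complex.Gamma (n j)) *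
          Complex.Gamma (α j.castSucc + n j))) * (Complex.Gamma (A + γ) / Complex.Gamma γ /
          Complex.Gamma A * Complex.betaIntegral (A + h) γ) := by
      rw [hint]
      ring
    _ = _ := by
      rw [hNC, hβ, add_right_comm A γ h]
      field_simp
end

section
/- Let k ≥ 1, and for j = 1, ..., k let n_j ≥ 1 be integers and B_j be n_j×n_j complex positive definite (self-adjoint) matrices. Let α_1, ..., α_{k+1} and h be complex numbers with Re(α_j) > 0 for j = 1, ..., k+1, Re(Σ_{j=1}^k (α_j + n_j) + h) > 0, and Re(α_{k+1} - h) > 0. Let f be the probability density on tuples (X_1, ..., X_k) of vectors X_j ∈ ℂ^{n_j} given by the type-2 form f(X_1,...,X_k) = G̃_k ∏_{j=1}^k (X_j* B_j X_j)^{α_j} · (1 + X_1* B_1 X_1 + ... + X_k* B_k X_k)^{-(α_1 + ... + α_{k+1} + n_1 + ... + n_k)}, where G̃_k = ( ∏_{j=1}^k det(B_j) (Γ(n_j)/π^{n_j}) (1/Γ(α_j + n_j)) ) · Γ(α_1 + ... + α_{k+1} + n_1 + ... + n_k) / Γ(α_{k+1}). Then the average of φ₉(X_1,...,X_k) = (X_1*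 B_1 X_1 + ... + X_k* B_k X_k)^h with respect to f equals ( Γ(Σ_{j=1}^k (α_j + n_j) + h) / Γ(Σ_{j=1}^k (α_j + n_j)) ) · ( Γ(α_{k+1} - h) / Γ(α_{k+1}) ). -/
open MeasureTheory Matrix
open scoped ComplexOrder

theorem integral_exp_mul_comp_exp (s : ℂ) (f : ℝ → ℂ) :
    ∫ x : ℝ, Complex.exp (s * x) * f (Real.exp x) = mellin f s := by
  rw [mellin, ← Real.range_exp, ← Set.image_univ,
    integral_image_eq_integral_abs_deriv_smul MeasurableSet.univ
      (fun x _ => (Real.hasDerivAt_exp x).hasDerivWithinAt) Real.exp_injective.injOn,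
    setIntegral_univ]
  congr 1 with x
  rw [abs_of_pos (Real.exp_pos x), Complex.real_smul, smul_eq_mul, ← mul_assoc,
    Complex.cpow_def_of_ne_zero (by simp), ← Complex.ofReal_log (Real.exp_pos x).le,
    Real.log_exp, Complex.ofReal_exp, ← Complex.exp_add]
  ring_nf

theorem integral_exp_mul_exp_neg_exp {s : ℂ} (hs : 0 < s.re) :
    ∫ x : ℝ, Complex.exp (s * x) * Complex.exp (-(Real.exp x : ℝ)) = Complex.Gamma s := by
  rw [integral_exp_mul_comp_exp s fun t : ℝ => Complex.exp (-t), Complex.Gamma_eq_integral hs,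
    Complex.GammaIntegral_eq_mellin]
  simp [mellin]

section Homogeneous

variable {V : Type*} [NormedAddCommGroup V] [NormedSpace ℝ V] [FiniteDimensional ℝ V]
  [MeasurableSpace V] [BorelSpace V] (μ : Measure V) [μ.IsAddHaarMeasure]

theorem map_smul_withDensity_of_homogeneous {m : ℕ} (hm : Module.finrank ℝ V = m)
    {w : V → ENNReal} (hw : Measurable w) {c : ℝ} (hc : 0 < c)
    (hcw : ∀ v, w v = ENNReal.ofReal (c ^ m) * w (c • v)) :
    (μ.withDensity w).map (c • ·) = μ.withDensity w := by
  refine Measure.ext_of_lintegral _ fun f hf => ?_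
  have hsm : Measurable (c • · : V → V) := measurable_const_smul c
  rw [lintegral_map hf hsm,
    lintegral_withDensity_eq_lintegral_mul _ hw (g := fun v => f (c • v)) (hf.comp hsm),
    lintegral_withDensity_eq_lintegral_mul _ hw hf]
  have h1 (v : V) : (w * fun a => f (c • a)) v = ENNReal.ofReal (c ^ m) * (w * f) (c • v) := by
    simp only [Pi.mul_apply]
    rw [hcw v, mul_assoc]
  have hpos : 0 < c ^ m := by positivity
  change ∫⁻ v, (w * fun a => f (c • a)) v ∂μ = _
  simp_rw [h1]
  rw [lintegral_const_mul _ (f := fun v => (w * f) (c • v)) ((hw.mul hf).comp hsm),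
    ← lintegral_map (f := w * f) (hw.mul hf) hsm, Measure.map_addHaar_smul μ hc.ne', hm,
    lintegral_smul_measure, smul_eq_mul, ← mul_assoc, ← ENNReal.ofReal_mul hpos.le,
    abs_of_pos (inv_pos.2 hpos), mul_inv_cancel₀ hpos.ne', ENNReal.ofReal_one, one_mul]

/-- The integral of `F * g ∘ N` for homogeneous `F` and `N` depends on `g` only through its Mellin
transform. The proof uses that the measure `N ^ (-m) dμ ⊗ dx` on `{N > 0} × ℝ` is preserved by
`(u, x) ↦ (exp ((x - log (N u)) / 2) • u, log (N u))`. -/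
theorem setIntegral_homogeneous_mul_integral {N : V → ℝ} (hN : Measurable N)
    (hNs : ∀ (x : ℝ) v, N (Real.exp (x / 2) • v) = Real.exp x * N v)
    {m : ℕ} (hm : Module.finrank ℝ V = 2 * m) {F : V → ℂ} (hF : Measurable F) (d : ℂ)
    (hFs : ∀ (x : ℝ) v, F (Real.exp (x / 2) • v) = Complex.exp (d * x) * F v)
    {g₁ g₂ : ℝ → ℂ} (hg₁ : Measurable g₁) (hg₂ : Measurable g₂) :
    (∫ v in {v | 0 < N v}, F v * g₁ (N v) ∂μ) *
        (∫ x : ℝ, Complex.exp ((d + m) * x) * g₂ (Real.exp x)) =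
      (∫ v in {v | 0 < N v}, F v * g₂ (N v) ∂μ) *
        (∫ x : ℝ, Complex.exp ((d + m) * x) * g₁ (Real.exp x)) := by
  have hS : MeasurableSet {v | 0 < N v} := measurableSet_lt measurable_const hN
  set w₀ : V → ENNReal := fun v => ENNReal.ofReal ((N v ^ m)⁻¹) with hw₀
  have hw₀m : Measurable w₀ := by fun_prop
  set τ : Measure V := μ.withDensity ({v | 0 < N v}.indicator w₀) with hτ
  have hτ' : τ = (μ.restrict {v | 0 < N v}).withDensity w₀ := withDensity_indicator hS _
  have hint (f : V → ℂ) : ∫ v, ((N v : ℂ) ^ m) * f v ∂τ = ∫ v in {v | 0 < N v}, f v ∂μ := by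
    rw [hτ', integral_withDensity_eq_integral_toReal_smul hw₀m (by simp [hw₀])]
    refine setIntegral_congr_fun hS fun v hv => ?_
    have hv' : 0 < N v := hv
    simp only [hw₀]
    rw [ENNReal.toReal_ofReal (by positivity), Complex.real_smul, ← mul_assoc]
    push_cast
    rw [inv_mul_cancel₀ (pow_ne_zero _ (by exact_mod_cast hv'.ne')), one_mul]
  have hscale (x : ℝ) : τ.map (Real.exp (x / 2) • ·) = τ := by
    refine map_smul_withDensity_of_homogeneous μ hm (hw₀m.indicator hS) (Real.exp_pos _) fun v => ?_
    by_cases hv : 0 < N v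
    · have hv' : 0 < N (Real.exp (x / 2) • v) := by rw [hNs]; positivity
      rw [Set.indicator_of_mem (show v ∈ {v | 0 < N v} from hv),
        Set.indicator_of_mem (show _ ∈ {v | 0 < N v} from hv')]
      simp only [hw₀]
      rw [← ENNReal.ofReal_mul (by positivity), hNs, pow_mul, ← Real.exp_nat_mul]
      have : ((2 : ℕ) : ℝ) * (x / 2) = x := by push_cast; ring
      rw [this, mul_pow, mul_inv, ← mul_assoc, mul_inv_cancel₀ (by positivity), one_mul]
    · have hv' : ¬ 0 < N (Real.exp (x / 2) • v) := by
        rw [hNs]; exact fun h => hv (pos_of_mul_pos_right h (Real.exp_pos x).le)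
      rw [Set.indicator_of_notMem (show v ∉ {v | 0 < N v} from hv),
        Set.indicator_of_notMem (show _ ∉ {v | 0 < N v} from hv'), mul_zero]
  have hlog : Measurable fun v => Real.log (N v) := Real.measurable_log.comp hN
  have m1 : MeasurePreserving (fun p : V × ℝ => (p.1, p.2 - Real.log (N p.1)))
      (τ.prod volume) (τ.prod volume) :=
    (MeasurePreserving.id τ).skew_product (g := fun v x => x - Real.log (N v))
      (measurable_snd.sub (hlog.comp measurable_fst))
      (ae_of_all _ fun v => (measurePreserving_sub_right volume _).map_eq)
  have m2 : MeasurePreserving (fun p : ℝ × V => (p.1, Real.exp (p.1 / 2) • p.2))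
      ((volume : Measure ℝ).prod τ) ((volume : Measure ℝ).prod τ) :=
    (MeasurePreserving.id volume).skew_product (g := fun x v => Real.exp (x / 2) • v)
      (by unfold Function.uncurry; fun_prop)
      (ae_of_all _ hscale)
  have m3 : MeasurePreserving (fun p : V × ℝ => (p.1, Real.log (N p.1) - p.2))
      (τ.prod volume) (τ.prod volume) :=
    (MeasurePreserving.id τ).skew_product (g := fun v x => Real.log (N v) - x)
      ((hlog.comp measurable_fst).sub measurable_snd)
      (ae_of_all _ fun v => (Measure.measurePreserving_sub_left volume _).map_eq)
  have mp := ((m3.comp Measure.measurePreserving_swap).comp m2).comp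
    (Measure.measurePreserving_swap.comp m1)
  set K : V × ℝ → ℂ := fun p => ((N p.1 : ℂ) ^ m * (F p.1 * g₂ (N p.1))) *
    (Complex.exp ((d + m) * p.2) * g₁ (Real.exp p.2)) with hK
  have hKm : Measurable K := by fun_prop
  have key := integral_map (μ := τ.prod volume) mp.measurable.aemeasurable hKm.aestronglyMeasurable
  rw [mp.map_eq, hK, integral_prod_mul (fun v => (N v : ℂ) ^ m * (F v * g₂ (N v)))
    (fun x : ℝ => Complex.exp ((d + m) * x) * g₁ (Real.exp x)), hint] at key
  rw [key, ← hint, ← integral_prod_mul]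
  have hae : ∀ᵐ p ∂(τ.prod (volume : Measure ℝ)), 0 < N p.1 := by
    refine Measure.quasiMeasurePreserving_fst.ae (p := fun v => 0 < N v) ?_
    rw [hτ']
    exact (withDensity_absolutelyContinuous _ _).ae_le (ae_restrict_mem hS)
  refine integral_congr_ae ?_
  filter_upwards [hae] with p hp
  obtain ⟨u, x⟩ := p
  simp only at hp
  have e1 : N (Real.exp ((x - Real.log (N u)) / 2) • u) = Real.exp x := by
    rw [hNs, Real.exp_sub, Real.exp_log hp, div_mul_cancel₀ _ hp.ne']
  have e2 : ((N u : ℝ) : ℂ) ^ m = Complex.exp (m * Real.log (N u)) := by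
    rw [Complex.exp_nat_mul, ← Complex.ofReal_exp, Real.exp_log hp]
  simp only [Function.comp_apply, Prod.swap_prod_mk, e1, hFs, Real.log_exp, sub_sub_cancel,
    Real.exp_log hp]
  rw [e2, Complex.ofReal_exp, ← Complex.exp_nat_mul]
  push_cast
  have e3 : Complex.exp ((d + m) * x) = Complex.exp (m * x) *
      Complex.exp (d * (x - Real.log (N u))) * Complex.exp (d * Real.log (N u)) := by
    rw [← Complex.exp_add, ← Complex.exp_add]; ring_nf
  have e4 : Complex.exp ((d + m) * Real.log (N u)) =
      Complex.exp (d * Real.log (N u)) * Complex.exp (m * Real.log (N u)) := by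
    rw [← Complex.exp_add]; ring_nf
  rw [e3, e4]
  ring

end Homogeneous

/-- The beta integral of the second kind, after the substitution `s = exp x`. -/
theorem integral_beta_prime {p q : ℂ} (hp : 0 < p.re) (hq : 0 < q.re) :
    (∫ x : ℝ, Complex.exp (p * x) * ((1 + Real.exp x : ℝ) : ℂ) ^ (-(p + q))) * Complex.Gamma (p + q)
      = Complex.Gamma p * Complex.Gamma q := by
  have hpq : 0 < (p + q).re := by simp; linarith
  rw [← integral_exp_mul_exp_neg_exp hp, ← integral_exp_mul_exp_neg_exp hq,
    ← integral_exp_mul_exp_neg_exp hpq, ← integral_prod_mul, ← integral_prod_mul]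
  have hmeas : Measurable fun x : ℝ => Real.log (1 + Real.exp x) := by fun_prop
  have m1 : MeasurePreserving (fun z : ℝ × ℝ => (z.1, z.2 - Real.log (1 + Real.exp z.1)))
      (volume.prod volume) (volume.prod volume) :=
    (MeasurePreserving.id volume).skew_product (g := fun s w => w - Real.log (1 + Real.exp s))
      (measurable_snd.sub (hmeas.comp measurable_fst))
      (ae_of_all _ fun s => (measurePreserving_sub_right volume _).map_eq)
  have m2 : MeasurePreserving (fun z : ℝ × ℝ => (z.1, z.2 + z.1))
      (volume.prod volume) (volume.prod volume) :=
    (MeasurePreserving.id volume).skew_product (g := fun y s => s + y)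
      (measurable_snd.add measurable_fst)
      (ae_of_all _ fun s => (measurePreserving_add_right volume _).map_eq)
  have mp := (Measure.measurePreserving_swap.comp m2).comp (Measure.measurePreserving_swap.comp m1)
  symm
  conv_lhs => rw [← mp.map_eq]
  rw [integral_map mp.measurable.aemeasurable
    (Measurable.aestronglyMeasurable (by fun_prop))]
  congr 1 with z
  obtain ⟨s, w⟩ := z
  have hs : 0 < 1 + Real.exp s := by positivity
  simp only [Function.comp_apply, Prod.swap_prod_mk]
  rw [Complex.cpow_def_of_ne_zero (by exact_mod_cast hs.ne'), ← Complex.ofReal_log hs.le]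
  simp only [← Complex.exp_add]
  have : Real.exp w = Real.exp (s + (w - Real.log (1 + Real.exp s))) +
      Real.exp (w - Real.log (1 + Real.exp s)) := by
    rw [Real.exp_add, Real.exp_sub, Real.exp_log hs]
    field_simp
    ring
  rw [this]
  congr 1
  push_cast
  ring_nf

theorem ofReal_exp_cpow (x : ℝ) (a : ℂ) : ((Real.exp x : ℝ) : ℂ) ^ a = Complex.exp (a * x) := by
  rw [Complex.cpow_def_of_ne_zero (by simp), ← Complex.ofReal_log (Real.exp_pos x).le,
    Real.log_exp, mul_comm]

theorem continuous_hermForm {n : ℕ} (B : Matrix (Fin n) (Fin n) ℂ) : Continuous (hermForm n B) := by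
  unfold hermForm
  fun_prop

theorem hermForm_exp_smul {n : ℕ} (B : Matrix (Fin n) (Fin n) ℂ) (x : ℝ) (v : Fin n → ℂ) :
    hermForm n B (Real.exp (x / 2) • v) = Real.exp x * hermForm n B v := by
  have h : Real.exp x = Real.exp (x / 2) * Real.exp (x / 2) := by
    rw [← Real.exp_add, add_halves]
  rw [hermForm, hermForm, star_smul, mulVec_smul, smul_dotProduct, dotProduct_smul, smul_smul,
    star_trivial, Complex.smul_re, smul_eq_mul, ← h]

theorem Matrix.PosDef.hermForm_pos {n : ℕ} {B : Matrix (Fin n) (Fin n) ℂ} (hB : B.PosDef)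
    {v : Fin n → ℂ} (hv : v ≠ 0) : 0 < hermForm n B v :=
  hB.re_dotProduct_pos hv

open scoped MatrixOrder in
theorem integral_exp_neg_hermForm {n : ℕ} {B : Matrix (Fin n) (Fin n) ℂ} (hB : B.PosDef) :
    ∫ X, Complex.exp (-(hermForm n B X : ℝ)) = (Real.pi : ℂ) ^ n / (B.det.re : ℂ) := by
  have hdet := hB.det_pos.ne'
  obtain ⟨C, rfl⟩ := CStarAlgebra.nonneg_iff_eq_star_mul_self.mp hB.posSemidef.nonneg
  have hC : C.det ≠ 0 := fun h => hdet (by rw [det_mul, h, mul_zero])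
  set L : (Fin n → ℂ) →ₗ[ℝ] (Fin n → ℂ) := (Matrix.toLin' C).restrictScalars ℝ with hL
  have hLdet : LinearMap.det L = Complex.normSq C.det := by
    rw [hL, LinearMap.det_restrictScalars, LinearMap.det_toLin', Algebra.norm_complex_apply]
  have hpos : 0 < Complex.normSq C.det := Complex.normSq_pos.2 hC
  have hBdet : (star C * C).det.re = Complex.normSq C.det := by
    rw [det_mul, star_eq_conjTranspose, det_conjTranspose, ← starRingEnd_apply,
      ← Complex.normSq_eq_conj_mul_self, Complex.ofReal_re]
  have hform (X : Fin n → ℂ) : Complex.exp (-(hermForm n (star C * C) X : ℝ)) =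
      ∏ i, Complex.exp (-1 * ‖L X i‖ ^ 2) := by
    rw [← Complex.exp_sum]
    congr 1
    have : hermForm n (star C * C) X = ∑ i, ‖L X i‖ ^ 2 := by
      rw [hermForm, ← mulVec_mulVec, star_eq_conjTranspose, dotProduct_mulVec, ← star_mulVec,
        dotProduct, Complex.re_sum]
      refine Finset.sum_congr rfl fun i _ => ?_
      rw [Pi.star_apply, ← starRingEnd_apply, ← Complex.normSq_eq_conj_mul_self,
        Complex.ofReal_re, Complex.normSq_eq_norm_sq]
      rfl
    rw [this]
    push_cast
    simp
  have hLm : Measurable L := L.continuous_of_finiteDimensional.measurable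
  have hone : ∫ z : ℂ, Complex.exp (-1 * ‖z‖ ^ 2) = Real.pi := by
    rw [GaussianFourier.integral_cexp_neg_mul_sq_norm (by simp), Complex.finrank_real_complex]
    simp
  have key := integral_map (μ := volume) hLm.aemeasurable
    (f := fun Y : Fin n → ℂ => ∏ i, Complex.exp (-1 * ‖Y i‖ ^ 2))
    (Measurable.aestronglyMeasurable (by fun_prop))
  simp_rw [hform]
  rw [← key, Measure.map_linearMap_addHaar_eq_smul_addHaar _ (by rw [hLdet]; exact hpos.ne'),
    integral_smul_measure, integral_fintype_prod_volume_eq_prod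
      (fun (_ : Fin n) (z : ℂ) => Complex.exp (-1 * ‖z‖ ^ 2)), hLdet, hBdet,
    ENNReal.toReal_ofReal (abs_nonneg _), abs_of_pos (inv_pos.2 hpos)]
  simp only [hone, Finset.prod_const, Finset.card_univ, Fintype.card_fin, Complex.real_smul]
  push_cast
  rw [div_eq_inv_mul]

theorem setIntegral_hermForm_cpow_mul_exp_neg {n : ℕ} (hn : 1 ≤ n)
    {B : Matrix (Fin n) (Fin n) ℂ} (hB : B.PosDef) {a : ℂ} (ha : 0 < (a + n).re) :
    ∫ X in {X | 0 < hermForm n B X},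
        (hermForm n B X : ℂ) ^ a * Complex.exp (-(hermForm n B X : ℝ)) =
      (Real.pi : ℂ) ^ n / (B.det.re : ℂ) / Complex.Gamma n * Complex.Gamma (a + n) := by
  have : Nonempty (Fin n) := ⟨⟨0, hn⟩⟩
  have hn0 : 0 < (n : ℂ).re := by simpa using Nat.lt_of_succ_le hn
  have h := setIntegral_homogeneous_mul_integral (volume : Measure (Fin n → ℂ))
    (continuous_hermForm B).measurable (hermForm_exp_smul B) (m := n)
    (by rw [Module.finrank_pi_fintype]; simp [mul_comm]) (F := fun _ => 1) measurable_const 0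
    (by simp) (g₁ := fun s => (s : ℂ) ^ a * Complex.exp (-s)) (g₂ := fun s => Complex.exp (-s))
    (by fun_prop) (by fun_prop)
  simp only [zero_add, one_mul] at h
  have hae : {X | 0 < hermForm n B X} =ᵐ[volume] (Set.univ : Set (Fin n → ℂ)) := by
    refine Filter.eventuallyEq_univ.2 ?_
    filter_upwards [compl_mem_ae_iff.2 (measure_singleton (0 : Fin n → ℂ))] with X hX
    exact hB.hermForm_pos hX
  rw [integral_exp_mul_exp_neg_exp hn0, setIntegral_congr_set hae (f := fun X =>
    Complex.exp (-(hermForm n B X : ℝ))), setIntegral_univ, integral_exp_neg_hermForm hB] at h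
  simp_rw [ofReal_exp_cpow, ← mul_assoc, ← Complex.exp_add (_ * _) (_ * _), ← add_mul] at h
  rw [add_comm _ a, integral_exp_mul_exp_neg_exp ha] at h
  rw [div_mul_eq_mul_div, ← h, mul_div_cancel_right₀ _ (Complex.Gamma_ne_zero_of_re_pos hn0)]

theorem stmt19 (k : ℕ) (hk : 1 ≤ k) (n : Fin k → ℕ) (hn : ∀ j, 1 ≤ n j)
    (B : (j : Fin k) → Matrix (Fin (n j)) (Fin (n j)) ℂ) (hB : ∀ j, (B j).PosDef)
    (α : Fin (k + 1) → ℂ) (h : ℂ)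
    (hα : ∀ j, 0 < (α j).re)
    (hh : 0 < ((∑ j : Fin k, (α j.castSucc + n j)) + h).re)
    (hh' : 0 < (α (Fin.last k) - h).re) :
    ∫ X in {X : (j : Fin k) → (Fin (n j) → ℂ) |
        ∀ j, 0 < hermForm (n j) (B j) (X j)},
      (((∑ j, hermForm (n j) (B j) (X j) : ℝ) : ℂ) ^ h *
        (((∏ j : Fin k, (((B j).det.re : ℂ) *
              (Complex.Gamma (n j) / (Real.pi : ℂ) ^ (n j : ℕ)) *
              (Complex.Gamma (α j.castSucc + n j))⁻¹)) *
            Complex.Gamma ((∑ j, α j) + ∑ j : Fin k, (n j : ℂ)) /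
            Complex.Gamma (α (Fin.last k))) *
          (∏ j : Fin k, ((hermForm (n j) (B j) (X j) : ℂ) ^ (α j.castSucc))) *
          (((1 + ∑ j, hermForm (n j) (B j) (X j) : ℝ) : ℂ) ^
            (-((∑ j, α j) + ∑ j : Fin k, (n j : ℂ))))))
      ∂(Measure.pi fun j : Fin k => (volume : Measure (Fin (n j) → ℂ)))
    = Complex.Gamma ((∑ j : Fin k, (α j.castSucc + n j)) + h) /
        Complex.Gamma (∑ j : Fin k, (α j.castSucc + n j)) *
        (Complex.Gamma (α (Fin.last k) - h) / Complex.Gamma (α (Fin.last k))) := by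
  have hne : Nonempty (Fin k) := ⟨⟨0, hk⟩⟩
  set q : (j : Fin k) → (Fin (n j) → ℂ) → ℝ := fun j => hermForm (n j) (B j) with hq
  set μ := Measure.pi fun j : Fin k => (volume : Measure (Fin (n j) → ℂ)) with hμ
  set N : ((j : Fin k) → Fin (n j) → ℂ) → ℝ := fun X => ∑ j, q j (X j) with hNdef
  set P : ((j : Fin k) → Fin (n j) → ℂ) → ℂ :=
    fun X => ∏ j, (q j (X j) : ℂ) ^ (α j.castSucc) with hP
  set S : Set ((j : Fin k) → Fin (n j) → ℂ) := {X | ∀ j, 0 < q j (X j)} with hSdef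
  set A : ℂ := ∑ j : Fin k, (α j.castSucc + n j) with hA
  set c : ℂ := (∑ j, α j) + ∑ j : Fin k, (n j : ℂ) with hc
  have hcA : c = A + α (Fin.last k) := by
    rw [hc, hA, Fin.sum_univ_castSucc, Finset.sum_add_distrib]; ring
  have hαn (j : Fin k) : 0 < (α j.castSucc + n j).re := by
    have := hα j.castSucc
    simp only [Complex.add_re, Complex.natCast_re]
    positivity
  have hA0 : 0 < A.re := by
    rw [hA, Complex.re_sum]
    exact Finset.sum_pos (fun j _ => hαn j) Finset.univ_nonempty
  have hqm (j : Fin k) : Measurable (q j) := (continuous_hermForm (B j)).measurable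
  have hS : MeasurableSet S := by
    rw [hSdef, Set.ofPred_forall]
    exact MeasurableSet.iInter fun j =>
      measurableSet_lt measurable_const ((hqm j).comp (measurable_pi_apply j))
  have hNm : Measurable N := by fun_prop
  have hPm : Measurable P := by fun_prop
  have hqs (x : ℝ) (X : (j : Fin k) → Fin (n j) → ℂ) (j : Fin k) :
      q j ((Real.exp (x / 2) • X) j) = Real.exp x * q j (X j) := hermForm_exp_smul _ _ _
  have hSN : S ⊆ {X | 0 < N X} := fun X hX =>
    Finset.sum_pos (fun j _ => hX j) Finset.univ_nonempty
  have hSs (x : ℝ) (X) : Real.exp (x / 2) • X ∈ S ↔ X ∈ S := by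
    refine forall_congr' fun j => ?_
    rw [hqs]
    exact mul_pos_iff_of_pos_left (Real.exp_pos x)
  have hset (g : ℝ → ℂ) :
      ∫ X in {X | 0 < N X}, S.indicator P X * g (N X) ∂μ = ∫ X in S, P X * g (N X) ∂μ := by
    have : (fun X => S.indicator P X * g (N X)) = S.indicator fun X => P X * g (N X) := by
      ext X
      exact (Set.indicator_mul_left S P fun X => g (N X)).symm
    rw [this, setIntegral_indicator hS, Set.inter_eq_right.2 hSN]
  have hfin : Module.finrank ℝ ((j : Fin k) → Fin (n j) → ℂ) = 2 * ∑ j, n j := by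
    rw [Module.finrank_pi_fintype, Finset.mul_sum]
    refine Finset.sum_congr rfl fun j _ => ?_
    rw [Module.finrank_pi_fintype]
    simp [mul_comm]
  have key := setIntegral_homogeneous_mul_integral μ hNm
    (fun x X => by simp only [hNdef, hqs, Finset.mul_sum]) hfin (hPm.indicator hS)
    (∑ j : Fin k, α j.castSucc) (fun x X => by
      by_cases hX : X ∈ S
      · rw [Set.indicator_of_mem hX, Set.indicator_of_mem ((hSs x X).2 hX)]
        simp only [hP, hqs]
        rw [Finset.sum_mul, Complex.exp_sum, ← Finset.prod_mul_distrib]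
        refine Finset.prod_congr rfl fun j _ => ?_
        rw [Complex.ofReal_mul, Complex.mul_cpow_ofReal_nonneg (Real.exp_pos x).le (hX j).le,
          ofReal_exp_cpow]
      · rw [Set.indicator_of_notMem hX, Set.indicator_of_notMem (mt (hSs x X).1 hX), mul_zero])
    (g₁ := fun s => (s : ℂ) ^ h * ((1 + s : ℝ) : ℂ) ^ (-c)) (g₂ := fun s => Complex.exp (-s))
    (by fun_prop) (by fun_prop)
  have hdm : (∑ j : Fin k, α j.castSucc) + ((∑ j, n j : ℕ) : ℂ) = A := by
    rw [hA, Finset.sum_add_distrib]; push_cast; rfl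
  rw [hset fun s => (s : ℂ) ^ h * ((1 + s : ℝ) : ℂ) ^ (-c), hset fun s => Complex.exp (-s), hdm,
    integral_exp_mul_exp_neg_exp hA0] at key
  have hgauss : ∫ X in S, P X * Complex.exp (-(N X : ℝ)) ∂μ =
      ∏ j, ((Real.pi : ℂ) ^ n j / ((B j).det.re : ℂ) / Complex.Gamma (n j) *
        Complex.Gamma (α j.castSucc + n j)) := by
    have hSpi : S = Set.univ.pi fun j => {X | 0 < q j X} := by
      ext X; simp [hSdef]
    have hPN (X) : P X * Complex.exp (-(N X : ℝ)) =
        ∏ j, ((q j (X j) : ℂ) ^ (α j.castSucc) * Complex.exp (-(q j (X j) : ℝ))) := by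
      rw [Finset.prod_mul_distrib, ← Complex.exp_sum, Finset.sum_neg_distrib]
      simp only [hNdef, hP, Complex.ofReal_sum]
    simp_rw [hPN]
    rw [hSpi, hμ, Measure.restrict_pi_pi, integral_fintype_prod_eq_prod
      (fun j X => (q j X : ℂ) ^ (α j.castSucc) * Complex.exp (-(q j X : ℝ)))]
    exact Finset.prod_congr rfl fun j _ =>
      setIntegral_hermForm_cpow_mul_exp_neg (hn j) (hB j) (hαn j)
  have hbeta := integral_beta_prime hh hh'
  have hsum : A + h + (α (Fin.last k) - h) = c := by rw [hcA]; ring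
  rw [hsum] at hbeta
  simp_rw [ofReal_exp_cpow, ← mul_assoc, ← Complex.exp_add (_ * _) (_ * _), ← add_mul] at key
  rw [hgauss] at key
  have hrw (X) : (N X : ℂ) ^ h * ((∏ j : Fin k, (((B j).det.re : ℂ) *
              (Complex.Gamma (n j) / (Real.pi : ℂ) ^ (n j : ℕ)) *
              (Complex.Gamma (α j.castSucc + n j))⁻¹)) *
            Complex.Gamma c / Complex.Gamma (α (Fin.last k)) * P X *
          ((1 + N X : ℝ) : ℂ) ^ (-c)) =
      ((∏ j : Fin k, (((B j).det.re : ℂ) *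
              (Complex.Gamma (n j) / (Real.pi : ℂ) ^ (n j : ℕ)) *
              (Complex.Gamma (α j.castSucc + n j))⁻¹)) *
            Complex.Gamma c / Complex.Gamma (α (Fin.last k))) *
        (P X * (N X : ℂ) ^ h * ((1 + N X : ℝ) : ℂ) ^ (-c)) := by ring
  change ∫ X in S, (N X : ℂ) ^ h * ((∏ j : Fin k, (((B j).det.re : ℂ) *
              (Complex.Gamma (n j) / (Real.pi : ℂ) ^ (n j : ℕ)) *
              (Complex.Gamma (α j.castSucc + n j))⁻¹)) *
            Complex.Gamma c / Complex.Gamma (α (Fin.last k)) * P X *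
          ((1 + N X : ℝ) : ℂ) ^ (-c)) ∂μ = _
  simp_rw [hrw]
  rw [integral_const_mul]
  have hprod : (∏ j : Fin k, (((B j).det.re : ℂ) *
              (Complex.Gamma (n j) / (Real.pi : ℂ) ^ (n j : ℕ)) *
              (Complex.Gamma (α j.castSucc + n j))⁻¹)) *
      ∏ j, ((Real.pi : ℂ) ^ n j / ((B j).det.re : ℂ) / Complex.Gamma (n j) *
        Complex.Gamma (α j.castSucc + n j)) = 1 := by
    rw [← Finset.prod_mul_distrib]
    refine Finset.prod_eq_one fun j _ => ?_
    have h1 : ((B j).det.re : ℂ) ≠ 0 :=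
      Complex.ofReal_ne_zero.2 (Complex.pos_iff.1 (hB j).det_pos).1.ne'
    have h2 : Complex.Gamma (n j) ≠ 0 :=
      Complex.Gamma_ne_zero_of_re_pos (by simpa using Nat.lt_of_succ_le (hn j))
    have h3 := Complex.Gamma_ne_zero_of_re_pos (hαn j)
    have h4 : (Real.pi : ℂ) ≠ 0 := Complex.ofReal_ne_zero.2 Real.pi_ne_zero
    field_simp
  have hΓA := Complex.Gamma_ne_zero_of_re_pos hA0
  have hΓl := Complex.Gamma_ne_zero_of_re_pos (hα (Fin.last k))
  set G := ∏ j : Fin k, (((B j).det.re : ℂ) *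
              (Complex.Gamma (n j) / (Real.pi : ℂ) ^ (n j : ℕ)) *
              (Complex.Gamma (α j.castSucc + n j))⁻¹)
  field_simp
  linear_combination G * Complex.Gamma c * key + Complex.Gamma c *
    (∫ x : ℝ, Complex.exp ((A + h) * x) * ((1 + Real.exp x : ℝ) : ℂ) ^ (-c)) * hprod + hbeta
end
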